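/- Fix an integer N ≥ 2, β > 0, k > 0 and θ > 0. Let ξ_1,…,ξ_{2N−1} be independent real random variables with ξ_{2n−1} distributed as the Gamma distribution with shape β(N−n)/2 + k and scale θ (for 1 ≤ n ≤ N) and ξ_{2n} distributed as the Gamma distribution with shape β(N−n)/2 and scale θ (for 1 ≤ n ≤ N−1). Define a_1 = ξ_1, a_n = ξ_{2n−2} + ξ_{2n−1} for 2 ≤ n ≤ N, and b_n = ξ_{2n−1} ξ_{2n} for 1 ≤ n ≤ N−1. Then the joint law of the decreasingly ordered eigenvalues (x_1 > … > x_N) of the random Jacobi matrix J_{a,b} is the probability measure on ℝ^N proportional to |Δ(x_1,…,x_N)|^β ∏_{n=1}^N x_n^{k−1} exp(−x_n/θ) restricted to the set {x ∈ (0,∞)^N : x_1 > … > x_N}. Equivalently, the eigenvalues of J_{a,b} form the Laguerre β-ensemble with potential V(x) = −(k−1)log(x) + x/θ on (0,∞). -/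

import Mathlib

open MeasureTheory ProbabilityTheory Matrix Finset Real
open scoped ENNReal NNReal

noncomputable section

/-- The symmetric tridiagonal (Jacobi) matrix with diagonal `a` and
off-diagonal entries `√(b n)`. -/
def jacobiMatrix {N : ℕ} (a : Fin N → ℝ) (b : Fin (N - 1) → ℝ) :
    Matrix (Fin N) (Fin N) ℝ :=
  Matrix.of fun i j =>
    if i = j then a i
    else if h : (i : ℕ) + 1 = (j : ℕ) then
      Real.sqrt (b ⟨i, by have := j.isLt; omega⟩)
    else if h' : (j : ℕ) + 1 = (i : ℕ) then
      Real.sqrt (b ⟨j, by have := i.isLt; omega⟩)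
    else 0

lemma jacobiMatrix_isHermitian {N : ℕ} (a : Fin N → ℝ) (b : Fin (N - 1) → ℝ) :
    (jacobiMatrix a b).IsHermitian := by
  unfold Matrix.IsHermitian
  ext i j
  simp only [jacobiMatrix, Matrix.conjTranspose_apply, Matrix.of_apply, star_trivial]
  by_cases hij : i = j
  · subst hij; simp
  · have hji : j ≠ i := fun h => hij h.symm
    rw [if_neg hji, if_neg hij]
    by_cases h1 : (j : ℕ) + 1 = (i : ℕ)
    · have h2 : ¬((i : ℕ) + 1 = (j : ℕ)) := by omega
      rw [dif_pos h1, dif_neg h2, dif_pos h1]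
    · by_cases h2 : (i : ℕ) + 1 = (j : ℕ)
      · rw [dif_neg h1, dif_pos h2, dif_pos h2]
      · rw [dif_neg h1, dif_neg h2, dif_neg h2, dif_neg h1]

/-- Reordering of a finite tuple in decreasing order. -/
def sortDesc {N : ℕ} (v : Fin N → ℝ) : Fin N → ℝ :=
  fun i => v (Tuple.sort v (Fin.rev i))

/-- The eigenvalues of the Jacobi matrix `J_{a,b}`, in decreasing order. -/
def jacobiEigs {N : ℕ} (a : Fin N → ℝ) (b : Fin (N - 1) → ℝ) : Fin N → ℝ :=
  sortDesc (jacobiMatrix_isHermitian a b).eigenvalues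

/-- The squared first coordinates of unit eigenvectors of the Jacobi matrix `J_{a,b}`,
indexed compatibly with `jacobiEigs` (decreasing eigenvalue order):
`jacobiWeights hN a b i` is the squared first coordinate of a unit eigenvector
associated with the eigenvalue `jacobiEigs a b i`. -/
def jacobiWeights {N : ℕ} (hN : 0 < N) (a : Fin N → ℝ) (b : Fin (N - 1) → ℝ) :
    Fin N → ℝ :=
  fun i =>
    ((jacobiMatrix_isHermitian a b).eigenvectorBasis
        (Tuple.sort (jacobiMatrix_isHermitian a b).eigenvalues (Fin.rev i)) ⟨0, hN⟩) ^ 2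

/-- The spectral map: Jacobi data `(a, b)` is sent to the decreasingly ordered
eigenvalues together with the first `N - 1` spectral weights. -/
def spectralMap {N : ℕ} (hN : 0 < N) (a : Fin N → ℝ) (b : Fin (N - 1) → ℝ) :
    (Fin N → ℝ) × (Fin (N - 1) → ℝ) :=
  ⟨jacobiEigs a b, fun i => jacobiWeights hN a b ⟨i, by have := i.isLt; omega⟩⟩

/-- The Vandermonde product `∏_{i<j} (x j - x i)`. -/
def vdm {N : ℕ} (x : Fin N → ℝ) : ℝ :=
  ∏ i : Fin N, ∏ j ∈ Finset.Ioi i, (x j - x i)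

/-- The open chamber of decreasing vectors `x 0 > x 1 > … `. -/
def chamber (N : ℕ) : Set (Fin N → ℝ) := {x | ∀ i j : Fin N, i < j → x j < x i}

/-- The open simplex of positive weights with sum `< 1`. -/
def openSimplex (N : ℕ) : Set (Fin (N - 1) → ℝ) :=
  {w | (∀ i, 0 < w i) ∧ ∑ i, w i < 1}

/-- Extension of `N - 1` weights by the last weight `1 - ∑ w`. -/
def wExt {N : ℕ} (w : Fin (N - 1) → ℝ) : Fin N → ℝ :=
  fun n => if h : (n : ℕ) < N - 1 then w ⟨n, h⟩ else 1 - ∑ i, w i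

/-- The first `N` coordinates of a vector of length `2N - 1`. -/
def xPart {N : ℕ} (p : Fin (2 * N - 1) → ℝ) : Fin N → ℝ :=
  fun i => p ⟨i, by have := i.isLt; omega⟩

/-- The last `N - 1` coordinates of a vector of length `2N - 1`. -/
def wPart {N : ℕ} (p : Fin (2 * N - 1) → ℝ) : Fin (N - 1) → ℝ :=
  fun i => p ⟨N + i, by have := i.isLt; omega⟩

/-- The diagonal coefficients `a` built from the parameters `ξ`:
`a 1 = ξ 1`, `a n = ξ (2n-2) + ξ (2n-1)` (in one-based notation). -/
def xiToA {N : ℕ} (ξ : Fin (2 * N - 1) → ℝ) : Fin N → ℝ :=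
  fun n =>
    if h : (n : ℕ) = 0 then ξ ⟨0, by have := n.isLt; omega⟩
    else ξ ⟨2 * (n : ℕ) - 1, by have := n.isLt; omega⟩ +
      ξ ⟨2 * (n : ℕ), by have := n.isLt; omega⟩

/-- The off-diagonal coefficients `b` built from the parameters `ξ`:
`b n = ξ (2n-1) * ξ (2n)` (in one-based notation). -/
def xiToB {N : ℕ} (ξ : Fin (2 * N - 1) → ℝ) : Fin (N - 1) → ℝ :=
  fun n => ξ ⟨2 * (n : ℕ), by have := n.isLt; omega⟩ *
    ξ ⟨2 * (n : ℕ) + 1, by have := n.isLt; omega⟩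

/-- The chain-sequence parameters `ξ` built from canonical moments `c`:
`ξ 1 = c 1` and `ξ n = (1 - c (n-1)) * c n` (in one-based notation). -/
def cToXi {N : ℕ} (c : Fin (2 * N - 1) → ℝ) : Fin (2 * N - 1) → ℝ :=
  fun k =>
    if (k : ℕ) = 0 then c k
    else (1 - c ⟨(k : ℕ) - 1, by have := k.isLt; omega⟩) * c k

/-- The lower bidiagonal matrix `Ξ` with diagonal `√ξ 1, √ξ 3, …` and
subdiagonal `√ξ 2, √ξ 4, …` (in one-based notation). -/
def bidiag {N : ℕ} (ξ : Fin (2 * N - 1) → ℝ) : Matrix (Fin N) (Fin N) ℝ :=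
  Matrix.of fun i j =>
    if i = j then Real.sqrt (ξ ⟨2 * (i : ℕ), by have := i.isLt; omega⟩)
    else if h : (j : ℕ) + 1 = (i : ℕ) then
      Real.sqrt (ξ ⟨2 * (j : ℕ) + 1, by have := i.isLt; omega⟩)
    else 0

lemma mul_transpose_isHermitian {N : ℕ} (A : Matrix (Fin N) (Fin N) ℝ) :
    (A * Aᵀ).IsHermitian := by
  unfold Matrix.IsHermitian
  ext i j
  simp [Matrix.mul_apply, Matrix.conjTranspose_apply, Matrix.transpose_apply, mul_comm]

section

/-- Weights of Dyck-type paths from height `j` to height `0` in `r` steps. -/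
def dyck (ξ : ℕ → ℝ) : ℕ → ℕ → ℝ
  | 0, 0 => 1
  | 0, _ + 1 => 0
  | r + 1, 0 => dyck ξ r 1
  | r + 1, j + 1 => dyck ξ r (j + 2) + ξ (j + 1) * dyck ξ r j

lemma dyck_zero_of_lt (ξ : ℕ → ℝ) : ∀ (r j : ℕ), r < j → dyck ξ r j = 0
  | 0, 0, h => by omega
  | 0, j + 1, _ => by simp [dyck]
  | r + 1, 0, h => by omega
  | r + 1, j + 1, h => by
      simp [dyck, dyck_zero_of_lt ξ r (j + 2) (by omega), dyck_zero_of_lt ξ r j (by omega)]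

lemma dyck_diag (ξ : ℕ → ℝ) (j : ℕ) : dyck ξ j j = ∏ n ∈ range j, ξ (n + 1) := by
  induction j with
  | zero => simp [dyck]
  | succ j ih =>
    rw [dyck, dyck_zero_of_lt ξ j (j + 2) (by omega), ih, prod_range_succ]; ring

lemma dyck_congr (ξ η : ℕ → ℝ) : ∀ (r j : ℕ), (∀ n, 1 ≤ n → 2 * n ≤ r + j → ξ n = η n) →
    dyck ξ r j = dyck η r j
  | 0, 0, _ => by simp [dyck]
  | 0, j + 1, _ => by simp [dyck]
  | r + 1, 0, h => by
      simp only [dyck]; exact dyck_congr ξ η r 1 (fun n h1 h2 => h n h1 (by omega))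
  | r + 1, j + 1, h => by
      simp only [dyck]
      rw [dyck_congr ξ η r (j + 2) (fun n h1 h2 => h n h1 (by omega))]
      by_cases hj : j ≤ r
      · rw [dyck_congr ξ η r j (fun n h1 h2 => h n h1 (by omega)), h (j + 1) (by omega) (by omega)]
      · rw [dyck_zero_of_lt ξ r j (by omega), dyck_zero_of_lt η r j (by omega)]; simp

lemma dyck_lead (ξ η : ℕ → ℝ) : ∀ (r j p : ℕ), j ≤ r → r + j = 2 * p →
    (∀ n, 1 ≤ n → n < p → ξ n = η n) →
    dyck ξ r j - ∏ n ∈ range p, ξ (n + 1) = dyck η r j - ∏ n ∈ range p, η (n + 1)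
  | 0, 0, p, _, h, _ => by
      obtain rfl : p = 0 := by omega
      simp [dyck]
  | 0, j + 1, p, h, _, _ => by omega
  | r + 1, 0, p, _, hp, h => by
      simp only [dyck]
      exact dyck_lead ξ η r 1 p (by omega) (by omega) h
  | r + 1, j + 1, p, hjr, hp, h => by
      by_cases hj : r = j
      · subst hj
        obtain rfl : p = r + 1 := by omega
        rw [dyck_diag, dyck_diag]; simp
      · simp only [dyck]
        have h1 := dyck_lead ξ η r (j + 2) p (by omega) (by omega) h
        rw [dyck_congr ξ η r j (fun n h1 h2 => h n h1 (by omega)), h (j + 1) (by omega) (by omega)]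
        linarith

/-- The unnormalised moments. -/
def mom (ξ : ℕ → ℝ) (k : ℕ) : ℝ := ξ 0 * dyck ξ (2 * k) 0

lemma mom_zero (ξ : ℕ → ℝ) : mom ξ 0 = ξ 0 := by simp [mom, dyck]

lemma mom_lead (ξ η : ℕ → ℝ) (k : ℕ) (h : ∀ n < k, ξ n = η n) :
    mom ξ k - ∏ n ∈ range (k + 1), ξ n = mom η k - ∏ n ∈ range (k + 1), η n := by
  rcases Nat.eq_zero_or_pos k with rfl | hk
  · simp [mom_zero]
  · have := dyck_lead ξ η (2 * k) 0 k (by omega) (by omega) (fun n _ h2 => h n h2)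
    simp only [mom, prod_range_succ', h 0 hk]
    linear_combination (η 0) * this

/-- Extension of a finite tuple by zero. -/
def ext0 {m : ℕ} (z : Fin m → ℝ) : ℕ → ℝ := fun n => if h : n < m then z ⟨n, h⟩ else 0

lemma ext0_apply {m : ℕ} (z : Fin m → ℝ) (i : Fin m) : ext0 z i = z i := by simp [ext0]

lemma ext0_of_lt {m : ℕ} (z : Fin m → ℝ) {n : ℕ} (h : n < m) : ext0 z n = z ⟨n, h⟩ := by
  simp [ext0, h]

/-- The moment map. -/
def Mmap {m : ℕ} (z : Fin m → ℝ) : Fin m → ℝ := fun k => mom (ext0 z) k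

lemma Mmap_injOn (m : ℕ) : Set.InjOn (Mmap (m := m)) {z | ∀ i, 0 < z i} := by
  intro z hz y hy h
  have key : ∀ k, (hk : k < m) → z ⟨k, hk⟩ = y ⟨k, hk⟩ := by
    intro k
    induction k using Nat.strong_induction_on with
    | _ k ih =>
      intro hk
      have hagree : ∀ n < k, ext0 z n = ext0 y n := by
        intro n hn
        rw [ext0_of_lt z (by omega), ext0_of_lt y (by omega)]; exact ih n hn _
      have h1 := mom_lead (ext0 z) (ext0 y) k hagree
      have h2 : mom (ext0 z) k = mom (ext0 y) k := congrFun h ⟨k, hk⟩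
      rw [h2, prod_range_succ, prod_range_succ, prod_congr rfl
        (fun n hn => hagree n (mem_range.1 hn))] at h1
      have hpos : 0 < ∏ n ∈ range k, ext0 y n := prod_pos (fun n hn => by
        rw [ext0_of_lt y (by have := mem_range.1 hn; omega)]; exact hy _)
      have h3 : ext0 z k = ext0 y k := by
        apply mul_left_cancel₀ hpos.ne'; linarith
      rwa [ext0_of_lt z hk, ext0_of_lt y hk] at h3
  funext i
  exact key i i.2

lemma contDiff_ext0 (m n : ℕ) : ContDiff ℝ 1 (fun z : Fin m → ℝ => ext0 z n) := by
  unfold ext0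
  by_cases h : n < m
  · simp only [h, dif_pos]; fun_prop
  · simp only [h, dif_neg, not_false_eq_true]; fun_prop

lemma contDiff_dyck (m : ℕ) : ∀ r j : ℕ, ContDiff ℝ 1 (fun z : Fin m → ℝ => dyck (ext0 z) r j)
  | 0, 0 => by simp only [dyck]; fun_prop
  | 0, j + 1 => by simp only [dyck]; fun_prop
  | r + 1, 0 => by simp only [dyck]; exact contDiff_dyck m r 1
  | r + 1, j + 1 => by
      simp only [dyck]
      exact (contDiff_dyck m r (j + 2)).add ((contDiff_ext0 m (j + 1)).mul (contDiff_dyck m r j))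

lemma contDiff_Mmap (m : ℕ) : ContDiff ℝ 1 (Mmap (m := m)) := by
  rw [contDiff_pi]
  intro k
  exact (contDiff_ext0 m 0).mul (contDiff_dyck m _ _)

/-- The Jacobian determinant of the moment map. -/
def Mdet {m : ℕ} (z : Fin m → ℝ) : ℝ := ∏ k ∈ range m, ∏ n ∈ range k, ext0 z n

lemma Mmap_partial {m : ℕ} (z : Fin m → ℝ) (k j : Fin m) (hkj : k ≤ j) :
    fderiv ℝ Mmap z (Pi.single j 1) k = if k = j then ∏ n ∈ range k, ext0 z n else 0 := by
  have hd : HasFDerivAt Mmap (fderiv ℝ Mmap z) z :=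
    ((contDiff_Mmap m).differentiable (by norm_num)).differentiableAt.hasFDerivAt
  have h1 := (hasFDerivAt_pi'.1 hd k)
  have h2 := h1.hasLineDerivAt (Pi.single j 1)
  have h3 : HasLineDerivAt ℝ (fun x => Mmap x k)
      (if k = j then ∏ n ∈ range k, ext0 z n else 0) z (Pi.single j 1) := by
    unfold HasLineDerivAt
    have heq : (fun t : ℝ => Mmap (z + t • Pi.single j (1 : ℝ)) k) =
        fun t => Mmap z k + t * (if k = j then ∏ n ∈ range k, ext0 z n else 0) := by
      funext t
      have hag : ∀ n < (k : ℕ), ext0 (z + t • Pi.single j (1 : ℝ)) n = ext0 z n := by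
        intro n hn
        have hn' : n < m := by omega
        rw [ext0_of_lt _ hn', ext0_of_lt _ hn']
        have : (⟨n, hn'⟩ : Fin m) ≠ j := by
          intro h; rw [← h, Fin.le_def] at hkj; simp at hkj; omega
        simp [Pi.single_eq_of_ne this]
      have := mom_lead _ _ k hag
      rw [prod_range_succ, prod_range_succ, prod_congr rfl
        (fun n hn => hag n (mem_range.1 hn)), ext0_apply, ext0_apply] at this
      change mom _ _ = mom _ _ + _
      by_cases hk : k = j
      · subst hk
        simp only [Pi.add_apply, Pi.smul_apply, Pi.single_eq_same, smul_eq_mul, mul_one] at this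
        simp only [if_true]
        linear_combination this
      · simp only [Pi.add_apply, Pi.smul_apply, Pi.single_eq_of_ne hk, smul_eq_mul, mul_zero,
          add_zero] at this
        simp only [hk, if_false]
        linear_combination this
    rw [heq]
    simpa using ((hasDerivAt_id (0 : ℝ)).mul_const
      (if k = j then ∏ n ∈ range k, ext0 z n else 0)).const_add (Mmap z k)
  have h4 := h2.unique h3
  simpa using h4

lemma det_fderiv_Mmap {m : ℕ} (z : Fin m → ℝ) : (fderiv ℝ Mmap z).det = Mdet z := by
  rw [ContinuousLinearMap.det, ← LinearMap.det_toMatrix']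
  rw [Matrix.det_of_lowerTriangular]
  · rw [Mdet, ← Fin.prod_univ_eq_prod_range (fun k => ∏ n ∈ range k, ext0 z n)]
    refine prod_congr rfl (fun k _ => ?_)
    have := Mmap_partial z k k le_rfl
    simpa [LinearMap.toMatrix'_apply] using this
  · intro i j hij
    have hij' : i < j := hij
    have := Mmap_partial z i j hij'.le
    simpa [LinearMap.toMatrix'_apply, hij'.ne] using this

lemma Mdet_pos {m : ℕ} (z : Fin m → ℝ) (hz : ∀ i, 0 < z i) : 0 < Mdet z := by
  refine prod_pos fun k hk => prod_pos fun n hn => ?_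
  have h1 := mem_range.1 hk
  have h2 := mem_range.1 hn
  rw [ext0_of_lt z (by omega)]; exact hz _

lemma Mmap_isOpen_image {m : ℕ} : IsOpen (Mmap '' {z : Fin m → ℝ | ∀ i, 0 < z i}) := by
  have hU : IsOpen {z : Fin m → ℝ | ∀ i, 0 < z i} := by
    simp only [Set.setOf_forall]
    exact isOpen_iInter_of_finite fun i => isOpen_lt continuous_const (continuous_apply i)
  rw [isOpen_iff_mem_nhds]
  rintro _ ⟨z, hz, rfl⟩
  have hs : HasStrictFDerivAt Mmap (fderiv ℝ Mmap z) z :=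
    (contDiff_Mmap m).contDiffAt.hasStrictFDerivAt (by norm_num)
  have hsurj : (fderiv ℝ Mmap z).range = ⊤ := by
    have hdet : LinearMap.det (fderiv ℝ Mmap z : (Fin m → ℝ) →ₗ[ℝ] (Fin m → ℝ)) ≠ 0 := by
      have := det_fderiv_Mmap z
      rw [ContinuousLinearMap.det] at this
      rw [this]; exact (Mdet_pos z hz).ne'
    have := (LinearMap.equivOfDetNeZero _ hdet).surjective
    exact LinearMap.range_eq_top.2 this
  rw [← hs.map_nhds_eq_of_surj hsurj]
  exact Filter.image_mem_map (hU.mem_nhds hz)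
end

section

/-- Index equivalence. -/
def eIdx {N m : ℕ} (hm : N + N = m) : Fin N ⊕ Fin N ≃ Fin m :=
  finSumFinEquiv.trans (finCongr hm)

@[simp] lemma eIdx_inl {N m : ℕ} (hm : N + N = m) (i : Fin N) :
    ((eIdx hm (Sum.inl i) : Fin m) : ℕ) = i := by simp [eIdx]

@[simp] lemma eIdx_inr {N m : ℕ} (hm : N + N = m) (i : Fin N) :
    ((eIdx hm (Sum.inr i) : Fin m) : ℕ) = N + i := by simp [eIdx, add_comm]

/-- The location part. -/
def xP {N m : ℕ} (hm : N + N = m) (y : Fin m → ℝ) : Fin N → ℝ := fun i => y (eIdx hm (Sum.inl i))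
/-- The weight part. -/
def wP {N m : ℕ} (hm : N + N = m) (y : Fin m → ℝ) : Fin N → ℝ := fun i => y (eIdx hm (Sum.inr i))

/-- Moments of the atomic measure with locations and weights. -/
def Pmap {N m : ℕ} (hm : N + N = m) (y : Fin m → ℝ) : Fin m → ℝ :=
  fun k => ∑ i, wP hm y i * xP hm y i ^ (k : ℕ)

lemma contDiff_Pmap {N m : ℕ} (hm : N + N = m) : ContDiff ℝ 1 (Pmap hm) := by
  rw [contDiff_pi]
  intro k
  unfold Pmap xP wP
  fun_prop

lemma fderiv_Pmap {N m : ℕ} (hm : N + N = m) (y v : Fin m → ℝ) (k : Fin m) :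
    fderiv ℝ (Pmap hm) y v k = ∑ i, (wP hm v i * xP hm y i ^ (k : ℕ) +
      wP hm y i * ((k : ℕ) * xP hm y i ^ ((k : ℕ) - 1)) * xP hm v i) := by
  have hd : HasFDerivAt (Pmap hm) (fderiv ℝ (Pmap hm) y) y :=
    ((contDiff_Pmap hm).differentiable (by norm_num)).differentiableAt.hasFDerivAt
  have h1 := (hasFDerivAt_pi'.1 hd k)
  have h2 := h1.hasLineDerivAt v
  have h3 : HasLineDerivAt ℝ (fun x => Pmap hm x k)
      (∑ i, (wP hm v i * xP hm y i ^ (k : ℕ) +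
      wP hm y i * ((k : ℕ) * xP hm y i ^ ((k : ℕ) - 1)) * xP hm v i)) y v := by
    unfold HasLineDerivAt Pmap
    apply HasDerivAt.fun_sum
    intro i _
    have ha : HasDerivAt (fun t : ℝ => wP hm (y + t • v) i) (wP hm v i) 0 := by
      simpa [wP] using ((hasDerivAt_id (0 : ℝ)).mul_const (wP hm v i)).const_add (wP hm y i)
    have hb : HasDerivAt (fun t : ℝ => xP hm (y + t • v) i) (xP hm v i) 0 := by
      simpa [xP] using ((hasDerivAt_id (0 : ℝ)).mul_const (xP hm v i)).const_add (xP hm y i)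
    have := ha.mul (hb.pow (k : ℕ))
    refine this.congr_deriv ?_
    simp [mul_assoc]
  have h4 := h2.unique h3
  simpa using h4

/-- The node polynomial. -/
def nodeP {N : ℕ} (x : Fin N → ℝ) : Polynomial ℝ := ∏ i, (Polynomial.X - Polynomial.C (x i))

lemma nodeP_monic {N : ℕ} (x : Fin N → ℝ) : (nodeP x).Monic :=
  Polynomial.monic_prod_of_monic _ _ fun i _ => Polynomial.monic_X_sub_C _

lemma nodeP_natDegree {N : ℕ} (x : Fin N → ℝ) : (nodeP x).natDegree = N := by
  simp [nodeP, Polynomial.natDegree_prod_of_monic _ _ (fun i _ => Polynomial.monic_X_sub_C (x i))]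

lemma nodeP_eval {N : ℕ} (x : Fin N → ℝ) (i : Fin N) : (nodeP x).eval (x i) = 0 := by
  rw [nodeP, Polynomial.eval_prod]
  exact prod_eq_zero (mem_univ i) (by simp)

lemma nodeP_derivative_eval {N : ℕ} (x : Fin N → ℝ) (i : Fin N) :
    (nodeP x).derivative.eval (x i) = ∏ j ∈ univ.erase i, (x i - x j) := by
  rw [nodeP, Polynomial.derivative_prod_finset, Polynomial.eval_finset_sum, Finset.sum_eq_single i]
  · simp [Polynomial.eval_prod]
  · intro j _ hj
    rw [Polynomial.eval_mul, Polynomial.eval_prod, prod_eq_zero (i := i)]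
    · simp
    · simp [hj.symm]
    · simp
  · simp

lemma abs_prod_nodeP {N : ℕ} (x : Fin N → ℝ) :
    |∏ i, (nodeP x).derivative.eval (x i)| = vdm x ^ 2 := by
  have h := Finset.prod_prod_Ioi_mul_eq_prod_prod_off_diag (fun i j : Fin N => |x j - x i|)
  rw [abs_prod, ← sq_abs, vdm, abs_prod, sq, ← prod_mul_distrib]
  simp only [nodeP_derivative_eval, abs_prod]
  rw [show (∏ i : Fin N, ∏ j ∈ univ.erase i, |x i - x j|) =
    ∏ i : Fin N, ∏ j ∈ {i}ᶜ, |x i - x j| from by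
      refine prod_congr rfl fun i _ => prod_congr ?_ fun _ _ => rfl
      ext; simp]
  rw [← h]
  refine prod_congr rfl fun i _ => ?_
  rw [← prod_mul_distrib]
  refine prod_congr rfl fun j _ => ?_
  rw [abs_sub_comm (x i) (x j)]

/-- Test polynomials. -/
def testP {N : ℕ} (x : Fin N → ℝ) : Fin N ⊕ Fin N → Polynomial ℝ
  | Sum.inl a => Polynomial.X ^ (a : ℕ)
  | Sum.inr a => Polynomial.X ^ (a : ℕ) * nodeP x

lemma testP_natDegree {N m : ℕ} (hm : N + N = m) (x : Fin N → ℝ) (r : Fin N ⊕ Fin N) :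
    (testP x r).natDegree = eIdx hm r := by
  rcases r with a | a
  · simp [testP]
  · rw [testP, Polynomial.natDegree_mul (by simp) (nodeP_monic x).ne_zero]
    simp [nodeP_natDegree, add_comm]

lemma sum_eIdx {N m : ℕ} (hm : N + N = m) (x : Fin N → ℝ) (r : Fin N ⊕ Fin N) (f : ℕ → ℝ) :
    ∑ t, (testP x r).coeff (eIdx hm t) * f (eIdx hm t) = (testP x r).sum (fun n c => c * f n) := by
  rw [(eIdx hm).sum_comp (fun t : Fin m => (testP x r).coeff t * f t),
    Fin.sum_univ_eq_sum_range (fun t => (testP x r).coeff t * f t),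
    Polynomial.sum_over_range' _ (by simp) m]
  rw [testP_natDegree hm]; exact (eIdx hm r).2

/-- Confluent Vandermonde matrix. -/
def cvM {N m : ℕ} (hm : N + N = m) (x w : Fin N → ℝ) : Matrix (Fin N ⊕ Fin N) (Fin N ⊕ Fin N) ℝ :=
  Matrix.of fun r c => Sum.elim (fun i => x i ^ (eIdx hm r : ℕ))
    (fun i => w i * ((eIdx hm r : ℕ) * x i ^ ((eIdx hm r : ℕ) - 1))) c

/-- Change of polynomial basis. -/
def cvL {N m : ℕ} (hm : N + N = m) (x : Fin N → ℝ) : Matrix (Fin N ⊕ Fin N) (Fin N ⊕ Fin N) ℝ :=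
  Matrix.of fun r t => (testP x r).coeff (eIdx hm t)

lemma det_cvL {N m : ℕ} (hm : N + N = m) (x : Fin N → ℝ) : (cvL hm x).det = 1 := by
  rw [← Matrix.fromBlocks_toBlocks (cvL hm x)]
  have h12 : (cvL hm x).toBlocks₁₂ = 0 := by
    ext a b
    simp only [cvL, toBlocks₁₂, testP, of_apply, Polynomial.coeff_X_pow, eIdx_inr, Matrix.zero_apply]
    rw [if_neg (by omega)]
  have h11 : (cvL hm x).toBlocks₁₁ = 1 := by
    ext a b
    simp only [cvL, toBlocks₁₁, testP, of_apply, Polynomial.coeff_X_pow, eIdx_inl, Matrix.one_apply,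
      Fin.ext_iff, eq_comm]
  rw [h12, Matrix.det_fromBlocks_zero₁₂, h11, Matrix.det_one, one_mul,
    Matrix.det_of_isLowerTriangular]
  · refine prod_eq_one fun a _ => ?_
    simp only [cvL, toBlocks₂₂, of_apply, eIdx_inr]
    have h := testP_natDegree hm x (Sum.inr a)
    rw [eIdx_inr] at h
    rw [← h]
    have : (testP x (Sum.inr a)).Monic := (Polynomial.monic_X_pow _).mul (nodeP_monic x)
    exact this
  · intro a b hab
    have hab' : a < b := hab
    simp only [cvL, toBlocks₂₂, of_apply, eIdx_inr]
    apply Polynomial.coeff_eq_zero_of_natDegree_lt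
    rw [testP_natDegree hm, eIdx_inr]
    have := Fin.lt_def.1 hab'
    omega

lemma cvL_mul_cvM {N m : ℕ} (hm : N + N = m) (x w : Fin N → ℝ) :
    cvL hm x * cvM hm x w = Matrix.fromBlocks (vandermonde x)ᵀ
      (Matrix.of fun a i => w i * (testP x (Sum.inl a)).derivative.eval (x i))
      0 ((vandermonde x)ᵀ * diagonal (fun i => w i * (nodeP x).derivative.eval (x i))) := by
  have hL : ∀ r i, (cvL hm x * cvM hm x w) r (Sum.inl i) = (testP x r).eval (x i) := by
    intro r i
    rw [Matrix.mul_apply, Polynomial.eval_eq_sum, ← sum_eIdx hm x r (fun n => x i ^ n)]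
    rfl
  have hR : ∀ r i, (cvL hm x * cvM hm x w) r (Sum.inr i) =
      w i * (testP x r).derivative.eval (x i) := by
    intro r i
    rw [Matrix.mul_apply, Polynomial.derivative_eval, Polynomial.sum, mul_sum]
    have := sum_eIdx hm x r (fun n => w i * (n * x i ^ (n - 1)))
    rw [Polynomial.sum] at this
    refine Eq.trans ?_ (this.trans ?_)
    · rfl
    · exact sum_congr rfl fun n _ => by ring
  ext r c
  rcases c with i | i
  · rw [hL]
    rcases r with a | a
    · simp [testP, vandermonde_apply]
    · simp [testP, nodeP_eval]
  · rw [hR]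
    rcases r with a | a
    · simp
    · simp [testP, nodeP_eval, vandermonde_apply, Matrix.mul_apply, diagonal_apply]
      ring

lemma abs_det_fderiv_Pmap {N m : ℕ} (hm : N + N = m) (y : Fin m → ℝ) :
    |(fderiv ℝ (Pmap hm) y).det| = |∏ i, wP hm y i| * vdm (xP hm y) ^ 4 := by
  have h1 : ((LinearMap.toMatrix' (fderiv ℝ (Pmap hm) y : (Fin m → ℝ) →ₗ[ℝ] (Fin m → ℝ))).submatrix
      (eIdx hm) ((Equiv.sumComm _ _).trans (eIdx hm))) = cvM hm (xP hm y) (wP hm y) := by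
    ext r c
    simp only [submatrix_apply, LinearMap.toMatrix'_apply, ContinuousLinearMap.coe_coe,
      fderiv_Pmap, cvM, of_apply]
    rcases c with i | i
    · simp only [xP, wP, Equiv.trans_apply, Equiv.sumComm_apply, Sum.swap_inl,
        Pi.single_apply, EmbeddingLike.apply_eq_iff_eq, Sum.elim_inl]
      simp
    · simp only [xP, wP, Equiv.trans_apply, Equiv.sumComm_apply, Sum.swap_inr,
        Pi.single_apply, EmbeddingLike.apply_eq_iff_eq, Sum.elim_inr]
      simp
  rw [ContinuousLinearMap.det, ← LinearMap.det_toMatrix',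
    ← Matrix.abs_det_submatrix_equiv_equiv (eIdx hm) ((Equiv.sumComm _ _).trans (eIdx hm)), h1]
  have h2 := congrArg Matrix.det (cvL_mul_cvM hm (xP hm y) (wP hm y))
  rw [Matrix.det_mul, det_cvL, one_mul, det_fromBlocks_zero₂₁, det_mul, det_diagonal,
    det_transpose, prod_mul_distrib] at h2
  rw [h2, abs_mul, abs_mul, abs_mul, abs_prod_nodeP, Matrix.det_vandermonde]
  change |vdm _| * (|vdm _| * _) = _
  rw [show ∀ a b c : ℝ, |a| * (|a| * (b * c)) = |a| ^ 2 * b * c from fun a b c => by ring, sq_abs]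
  ring
end

section

lemma Pmap_poly {N m : ℕ} (hm : N + N = m) (y y' : Fin m → ℝ) (h : Pmap hm y = Pmap hm y')
    (q : Polynomial ℝ) (hq : q.natDegree < m) :
    ∑ i, wP hm y i * q.eval (xP hm y i) = ∑ i, wP hm y' i * q.eval (xP hm y' i) := by
  have key : ∀ y : Fin m → ℝ, ∑ i, wP hm y i * q.eval (xP hm y i) =
      ∑ k : Fin m, q.coeff k * Pmap hm y k := by
    intro y
    simp only [Polynomial.eval_eq_sum_range' hq, Pmap, mul_sum]
    rw [sum_comm, Finset.sum_range]
    refine sum_congr rfl fun k _ => sum_congr rfl fun i _ => by ring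
  rw [key, key, h]

/-- Data with ordered locations and positive weights. -/
def W0 {N m : ℕ} (hm : N + N = m) : Set (Fin m → ℝ) :=
  {y | xP hm y ∈ chamber N ∧ ∀ i, 0 < wP hm y i}

lemma chamber_inj {N : ℕ} {x : Fin N → ℝ} (hx : x ∈ chamber N) : Function.Injective x := by
  intro i j hij
  rcases lt_trichotomy i j with h | h | h
  · exact absurd hij (hx i j h).ne'
  · exact h
  · exact absurd hij (hx j i h).ne

lemma Pmap_range {N m : ℕ} (hm : N + N = m) (y y' : Fin m → ℝ) (hy' : y' ∈ W0 hm)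
    (h : Pmap hm y = Pmap hm y') : Set.range (xP hm y') ⊆ Set.range (xP hm y) := by
  rintro _ ⟨i, rfl⟩
  by_contra hcon
  have hN : 0 < N := i.pos
  set q : Polynomial ℝ := nodeP (xP hm y) *
    ∏ j ∈ univ.erase i, (Polynomial.X - Polynomial.C (xP hm y' j)) with hqdef
  have hmon : (∏ j ∈ univ.erase i, (Polynomial.X - Polynomial.C (xP hm y' j))).Monic :=
    Polynomial.monic_prod_of_monic _ _ fun i _ => Polynomial.monic_X_sub_C _
  have hq : q.natDegree < m := by
    rw [hqdef, (nodeP_monic _).natDegree_mul hmon, nodeP_natDegree,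
      Polynomial.natDegree_prod_of_monic _ _ (fun i _ => Polynomial.monic_X_sub_C _)]
    simp
    omega
  have h1 := Pmap_poly hm y y' h q hq
  rw [sum_eq_zero (fun j _ => by rw [hqdef, Polynomial.eval_mul, nodeP_eval]; ring),
    sum_eq_single i] at h1
  · have h2 : q.eval (xP hm y' i) ≠ 0 := by
      rw [hqdef, Polynomial.eval_mul, nodeP, Polynomial.eval_prod, Polynomial.eval_prod]
      refine mul_ne_zero (prod_ne_zero_iff.2 fun j _ => ?_) (prod_ne_zero_iff.2 fun j hj => ?_)
      · simp only [Polynomial.eval_sub, Polynomial.eval_X, Polynomial.eval_C, sub_ne_zero]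
        exact fun h => hcon ⟨j, h.symm⟩
      · simp only [Polynomial.eval_sub, Polynomial.eval_X, Polynomial.eval_C, sub_ne_zero]
        exact fun h => (mem_erase.1 hj).1 (chamber_inj hy'.1 h).symm
    exact mul_ne_zero (hy'.2 i).ne' h2 h1.symm
  · intro j _ hj
    rw [hqdef, Polynomial.eval_mul, Polynomial.eval_prod, prod_eq_zero (i := j)]
    · simp
    · simp [hj]
    · simp
  · simp

lemma Pmap_injOn {N m : ℕ} (hm : N + N = m) : Set.InjOn (Pmap hm) (W0 hm) := by
  intro y hy y' hy' h
  have hr : Set.range (xP hm y) = Set.range (xP hm y') :=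
    Set.Subset.antisymm (Pmap_range hm y' y hy h.symm) (Pmap_range hm y y' hy' h)
  have hs : ∀ x ∈ chamber N, StrictMono (fun i => - x i) :=
    fun x hx i j hij => neg_lt_neg (hx i j hij)
  have hx : xP hm y = xP hm y' := by
    have h1 : Set.range (fun i => - xP hm y i) = Set.range (fun i => - xP hm y' i) := by
      have : ∀ x : Fin N → ℝ, Set.range (fun i => - x i) = (fun t => -t) '' Set.range x := by
        intro x; rw [← Set.range_comp]; rfl
      rw [this, this, hr]
    have h2 := ((hs _ hy.1).range_inj (hs _ hy'.1)).1 h1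
    funext i
    exact neg_injective (congrFun h2 i)
  have hw : wP hm y = wP hm y' := by
    funext i
    set q : Polynomial ℝ := 
      ∏ j ∈ univ.erase i, (Polynomial.X - Polynomial.C (xP hm y' j)) with hqdef
    have hq : q.natDegree < m := by
      rw [hqdef, Polynomial.natDegree_prod_of_monic _ _ (fun i _ => Polynomial.monic_X_sub_C _)]
      have := i.pos
      simp
      omega
    have h1 := Pmap_poly hm y y' h q hq
    rw [hx] at h1
    have hz : ∀ j, j ≠ i → q.eval (xP hm y' j) = 0 := by
      intro j hj
      rw [hqdef, Polynomial.eval_prod, prod_eq_zero (i := j)]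
      · simp [hj]
      · simp
    rw [sum_eq_single i (fun j _ hj => by rw [hz j hj, mul_zero]) (by simp),
      sum_eq_single i (fun j _ hj => by rw [hz j hj, mul_zero]) (by simp)] at h1
    refine mul_right_cancel₀ ?_ h1
    rw [hqdef, Polynomial.eval_prod]
    refine prod_ne_zero_iff.2 fun j hj => ?_
    simp only [Polynomial.eval_sub, Polynomial.eval_X, Polynomial.eval_C, sub_ne_zero]
    exact fun h => (mem_erase.1 hj).1 (chamber_inj hy'.1 h).symm
  funext k
  obtain ⟨r, rfl⟩ := (eIdx hm).surjective k
  rcases r with i | i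
  · exact congrFun hx i
  · exact congrFun hw i

lemma hankel_det {N : ℕ} (x w : Fin N → ℝ) :
    (Matrix.of fun a b : Fin N => ∑ i, w i * x i ^ ((a : ℕ) + (b : ℕ))).det =
      (∏ i, w i) * vdm x ^ 2 := by
  have : (Matrix.of fun a b : Fin N => ∑ i, w i * x i ^ ((a : ℕ) + (b : ℕ))) =
      (vandermonde x)ᵀ * diagonal w * vandermonde x := by
    ext a b
    simp only [of_apply, Matrix.mul_apply, transpose_apply, vandermonde_apply, diagonal_apply,
      mul_ite, mul_zero, sum_ite_eq', mem_univ, if_true]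
    refine sum_congr rfl fun i _ => by rw [pow_add]; ring
  rw [this, det_mul, det_mul, det_transpose, det_diagonal, det_vandermonde, vdm]
  ring
end

section

lemma sum_ite_val {N : ℕ} (c : ℕ) (s : ℝ) (y : Fin N → ℝ) :
    ∑ l : Fin N, (if (l : ℕ) = c then s * y l else 0) = s * ext0 y c := by
  by_cases h : c < N
  · rw [ext0_of_lt y h, sum_eq_single ⟨c, h⟩]
    · simp
    · intro b _ hb
      rw [if_neg]
      intro h'; exact hb (Fin.ext h')
    · simp
  · rw [sum_eq_zero]
    · simp [ext0, h]
    · intro l _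
      rw [if_neg]; have := l.2; omega

lemma bidiag_apply {N : ℕ} (z : Fin (2 * N - 1) → ℝ) (i j : Fin N) :
    bidiag z i j = (if (j : ℕ) = i then √(ext0 z (2 * i)) else 0) +
      (if (j : ℕ) + 1 = i then √(ext0 z (2 * j + 1)) else 0) := by
  have hi := i.2
  have hj := j.2
  simp only [bidiag, of_apply, Fin.ext_iff]
  by_cases h : (i : ℕ) = j
  · rw [if_pos h, if_pos h.symm, if_neg (by omega), ext0_of_lt z (by omega)]; simp
  · rw [if_neg h, if_neg (Ne.symm h)]
    by_cases h' : (j : ℕ) + 1 = i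
    · rw [dif_pos h', if_pos h', ext0_of_lt z (by omega)]; simp
    · rw [dif_neg h', if_neg h']; simp

lemma bidiag_row {N : ℕ} (z : Fin (2 * N - 1) → ℝ) (i : Fin N) (y : Fin N → ℝ) :
    ∑ l, bidiag z i l * y l = √(ext0 z (2 * i)) * ext0 y i +
      (if (i : ℕ) = 0 then 0 else √(ext0 z (2 * i - 1)) * ext0 y (i - 1)) := by
  rw [← sum_ite_val (i : ℕ)]
  by_cases hi : (i : ℕ) = 0
  · rw [if_pos hi, add_zero]
    refine sum_congr rfl fun l _ => ?_
    rw [bidiag_apply, if_neg (by omega : ¬ ((l : ℕ) + 1 = i)), add_zero, ite_mul, zero_mul]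
  · rw [if_neg hi, ← sum_ite_val, ← sum_add_distrib]
    refine sum_congr rfl fun l _ => ?_
    rw [bidiag_apply, add_mul, ite_mul, ite_mul, zero_mul]
    congr 1
    by_cases h : (l : ℕ) + 1 = i
    · rw [if_pos h, if_pos (by omega), show 2 * (i : ℕ) - 1 = 2 * l + 1 by omega]
    · rw [if_neg h, if_neg (by omega)]

lemma bidiag_col {N : ℕ} (z : Fin (2 * N - 1) → ℝ) (i : Fin N) (y : Fin N → ℝ) :
    ∑ l, bidiag z l i * y l = √(ext0 z (2 * i)) * ext0 y i +
      √(ext0 z (2 * i + 1)) * ext0 y (i + 1) := by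
  rw [← sum_ite_val (i : ℕ), ← sum_ite_val ((i : ℕ) + 1), ← sum_add_distrib]
  refine sum_congr rfl fun l _ => ?_
  rw [bidiag_apply, add_mul, ite_mul, ite_mul, zero_mul]
  congr 1
  · by_cases h : (i : ℕ) = l
    · rw [if_pos h, if_pos h.symm, h]
    · rw [if_neg h, if_neg (Ne.symm h)]
  · by_cases h : (i : ℕ) + 1 = l
    · rw [if_pos h, if_pos h.symm]
    · rw [if_neg h, if_neg (Ne.symm h)]

lemma ext0_nonneg {m : ℕ} {z : Fin m → ℝ} (hz : ∀ i, 0 ≤ z i) (n : ℕ) : 0 ≤ ext0 z n := by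
  unfold ext0; split_ifs
  · exact hz _
  · exact le_rfl

/-- The Jacobi matrix of the parameters. -/
abbrev JM {N : ℕ} (z : Fin (2 * N - 1) → ℝ) : Matrix (Fin N) (Fin N) ℝ :=
  jacobiMatrix (xiToA z) (xiToB z)

lemma JM_eq {N : ℕ} (z : Fin (2 * N - 1) → ℝ) (hz : ∀ i, 0 ≤ z i) :
    JM z = bidiag z * (bidiag z)ᵀ := by
  ext i j
  have hi := i.2
  have hj := j.2
  have hs : ∀ n, √(ext0 z n) * √(ext0 z n) = ext0 z n := fun n => Real.mul_self_sqrt (ext0_nonneg hz n)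
  rw [Matrix.mul_apply]
  simp only [transpose_apply]
  rw [bidiag_row z i (fun l => bidiag z j l)]
  rw [ext0_of_lt _ hi, bidiag_apply]
  simp only [JM, jacobiMatrix, of_apply, xiToA, xiToB, Fin.ext_iff]
  by_cases h0 : (i : ℕ) = 0
  · rw [if_pos h0]
    by_cases h1 : (i : ℕ) = j
    · rw [if_pos h1, if_pos h1, dif_pos h0, if_neg (by omega), ← h1, h0, add_zero, mul_add, hs,
        ext0_of_lt z (by omega)]
      simp
    · rw [if_neg h1, if_neg h1]
      by_cases h2 : (i : ℕ) + 1 = j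
      · rw [dif_pos h2, if_pos h2, ← ext0_of_lt z, ← ext0_of_lt z,
          Real.sqrt_mul (ext0_nonneg hz _)]; simp
      · rw [dif_neg h2, if_neg h2, dif_neg (by omega)]; simp
  · rw [if_neg h0, ext0_of_lt (fun l => bidiag z j l) (by omega), bidiag_apply]
    simp only
    by_cases h1 : (i : ℕ) = j
    · rw [if_pos h1, if_pos h1, dif_neg h0, if_neg (by omega), if_neg (by omega), if_pos (by omega),
        ← h1, show 2 * ((i : ℕ) - 1) + 1 = 2 * i - 1 by omega, zero_add, add_zero, hs, hs,
        ← ext0_of_lt z, ← ext0_of_lt z]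
      ring
    · rw [if_neg h1, if_neg h1]
      by_cases h2 : (i : ℕ) + 1 = j
      · rw [dif_pos h2, if_pos h2, if_neg (by omega), if_neg (by omega), ← ext0_of_lt z,
          ← ext0_of_lt z, Real.sqrt_mul (ext0_nonneg hz _)]; simp
      · rw [dif_neg h2, if_neg h2]
        by_cases h3 : (j : ℕ) + 1 = i
        · rw [dif_pos h3, if_pos (by omega), if_neg (by omega), ← ext0_of_lt z,
            ← ext0_of_lt z, Real.sqrt_mul (ext0_nonneg hz _), ← h3]
          simp
          rw [show 2 * ((j : ℕ) + 1) - 1 = 2 * j + 1 by omega]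
          ring
        · rw [dif_neg h3, if_neg (by omega), if_neg (by omega)]; simp

lemma ext0_bidiag_col {N : ℕ} (z : Fin (2 * N - 1) → ℝ) (y : Fin N → ℝ) (n : ℕ) (hn : n < N) :
    ext0 (fun i => ∑ l, bidiag z l i * y l) n = √(ext0 z (2 * n)) * ext0 y n +
      √(ext0 z (2 * n + 1)) * ext0 y (n + 1) := by
  rw [ext0_of_lt _ hn, bidiag_col]

lemma JM_action {N : ℕ} (z : Fin (2 * N - 1) → ℝ) (hz : ∀ i, 0 ≤ z i) (y : Fin N → ℝ)
    (i : Fin N) :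
    ∑ l, JM z i l * y l = √(ext0 z (2 * i)) * (√(ext0 z (2 * i)) * ext0 y i +
      √(ext0 z (2 * i + 1)) * ext0 y (i + 1)) +
      (if (i : ℕ) = 0 then 0 else √(ext0 z (2 * i - 1)) * (√(ext0 z (2 * (i - 1))) * ext0 y (i - 1) +
      √(ext0 z (2 * i - 1)) * ext0 y i)) := by
  have h1 : ∑ l, JM z i l * y l = ∑ l, bidiag z i l * (∑ l', bidiag z l' l * y l') := by
    rw [JM_eq z hz]
    simp only [Matrix.mul_apply, transpose_apply, sum_mul, mul_sum]
    rw [sum_comm]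
    refine sum_congr rfl fun _ _ => sum_congr rfl fun _ _ => by ring
  rw [h1, bidiag_row z i (fun l => ∑ l', bidiag z l' l * y l'), ext0_bidiag_col z y _ i.2]
  by_cases h0 : (i : ℕ) = 0
  · rw [if_pos h0, if_pos h0]
  · rw [if_neg h0, if_neg h0, ext0_bidiag_col z y _ (by omega),
      show 2 * ((i : ℕ) - 1) + 1 = 2 * i - 1 by omega, show (i : ℕ) - 1 + 1 = i by omega]

/-- Product of off-diagonal entries. -/
def dd {N : ℕ} (z : Fin (2 * N - 1) → ℝ) (n : ℕ) : ℝ :=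
  ∏ i ∈ range n, (√(ext0 z (2 * i)) * √(ext0 z (2 * i + 1)))

lemma JM_pow_succ {N : ℕ} (hN : 0 < N) (z : Fin (2 * N - 1) → ℝ) (k : ℕ) (i : Fin N) :
    (JM z ^ (k + 1)) i ⟨0, hN⟩ = ∑ l, JM z i l * (JM z ^ k) l ⟨0, hN⟩ := by
  rw [pow_succ', Matrix.mul_apply]

lemma JM_pow_zero {N : ℕ} (hN : 0 < N) (z : Fin (2 * N - 1) → ℝ) (i : Fin N) :
    (JM z ^ 0) i ⟨0, hN⟩ = if (i : ℕ) = 0 then 1 else 0 := by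
  rw [pow_zero, Matrix.one_apply]; simp [Fin.ext_iff]

lemma dyck_big {N : ℕ} (ξ : ℕ → ℝ) (hξ : ∀ n, 2 * N ≤ n → ξ n = 0) :
    ∀ r j, 1 ≤ j → 2 * N ≤ j → dyck ξ r j = 0
  | 0, 0, h, _ => by omega
  | 0, j + 1, _, _ => by simp [dyck]
  | r + 1, 0, h, _ => by omega
  | r + 1, j + 1, h, h' => by
      rw [dyck, dyck_big ξ hξ r (j + 2) (by omega) (by omega), hξ _ h']; ring

lemma dyck_two (ξ : ℕ → ℝ) (k n : ℕ) : dyck ξ (2 * (k + 1)) (2 * n) =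
    dyck ξ (2 * k) (2 * (n + 1)) + ξ (2 * n + 1) * dyck ξ (2 * k) (2 * n) +
    (if n = 0 then 0 else ξ (2 * n) * (dyck ξ (2 * k) (2 * n) +
      ξ (2 * n - 1) * dyck ξ (2 * k) (2 * (n - 1)))) := by
  rcases n with _ | n
  · simp [dyck, mul_add]
  · simp only [mul_add, mul_one, dyck]
    simp

lemma JM_dyck {N : ℕ} (hN : 0 < N) (z : Fin (2 * N - 1) → ℝ) (hz : ∀ i, 0 ≤ z i)
    (ξ : ℕ → ℝ) (hξ : ∀ n, ξ (n + 1) = ext0 z n) (k : ℕ) : ∀ i : Fin N,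
    dd z i * (JM z ^ k) i ⟨0, hN⟩ = dyck ξ (2 * k) (2 * i) := by
  have hs : ∀ n, √(ext0 z n) * √(ext0 z n) = ext0 z n := fun n => Real.mul_self_sqrt (ext0_nonneg hz n)
  have hξ0 : ∀ n, 2 * N ≤ n → ξ n = 0 := by
    intro n hn
    obtain ⟨n, rfl⟩ : ∃ l, n = l + 1 := ⟨n - 1, by omega⟩
    rw [hξ]; unfold ext0; rw [dif_neg (by omega)]
  induction k with
  | zero =>
    intro i
    rw [JM_pow_zero]
    by_cases h0 : (i : ℕ) = 0
    · simp [h0, dd, dyck]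
    · rw [if_neg h0, dyck_zero_of_lt _ _ _ (by omega), mul_zero]
  | succ k ih =>
    have ih' : ∀ n, dd z n * ext0 (fun l => (JM z ^ k) l ⟨0, hN⟩) n = dyck ξ (2 * k) (2 * n) := by
      intro n
      by_cases hn : n < N
      · rw [ext0_of_lt _ hn]; exact ih ⟨n, hn⟩
      · rw [dyck_big ξ hξ0 _ _ (by omega) (by omega)]
        unfold ext0; rw [dif_neg hn, mul_zero]
    intro i
    rw [JM_pow_succ, JM_action z hz (fun l => (JM z ^ k) l ⟨0, hN⟩), dyck_two, ← ih', ← ih', hξ]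
    have hd : dd z (i + 1) = dd z i * (√(ext0 z (2 * i)) * √(ext0 z (2 * i + 1))) := by
      rw [dd, prod_range_succ]; rfl
    by_cases h0 : (i : ℕ) = 0
    · rw [if_pos h0, if_pos h0, hd]
      linear_combination dd z i * ext0 (fun l => (JM z ^ k) l ⟨0, hN⟩) i * hs (2 * i)
    · rw [if_neg h0, if_neg h0, hd, ← ih']
      obtain ⟨n, hn⟩ : ∃ n, (i : ℕ) = n + 1 := ⟨i - 1, by omega⟩
      have hd2 : dd z (n + 1) = dd z n * (√(ext0 z (2 * n)) * √(ext0 z (2 * n + 1))) := by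
        rw [dd, prod_range_succ]; rfl
      rw [hn, show 2 * (n + 1) - 1 = 2 * n + 1 by omega, show n + 1 - 1 = n by omega,
        show 2 * (n + 1) = 2 * n + 1 + 1 by ring, hξ, hξ, hd2]
      set e := ext0 (fun l => (JM z ^ k) l ⟨0, hN⟩)
      have a1 := hs (2 * n)
      have a2 := hs (2 * n + 1)
      have a3 := hs (2 * n + 1 + 1)
      set s1 := √(ext0 z (2 * n))
      set s2 := √(ext0 z (2 * n + 1))
      set s3 := √(ext0 z (2 * n + 1 + 1))
      rw [← a1, ← a2, ← a3]
      ring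

lemma JM_tri {N : ℕ} (hN : 0 < N) (z : Fin (2 * N - 1) → ℝ) (hz : ∀ i, 0 ≤ z i)
    (k : ℕ) : ∀ i : Fin N, k ≤ i →
    (JM z ^ k) i ⟨0, hN⟩ = if (i : ℕ) = k then dd z k else 0 := by
  induction k with
  | zero =>
    intro i _
    rw [JM_pow_zero]; simp [dd]
  | succ k ih =>
    have ih' : ∀ n, k ≤ n → n < N → ext0 (fun l => (JM z ^ k) l ⟨0, hN⟩) n =
        if n = k then dd z k else 0 := by
      intro n hn hn'
      rw [ext0_of_lt _ hn']; exact ih ⟨n, hn'⟩ hn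
    intro i hi
    have h1 : ext0 (fun l => (JM z ^ k) l ⟨0, hN⟩) (i + 1) = 0 := by
      by_cases hn : (i : ℕ) + 1 < N
      · rw [ih' _ (by omega) hn, if_neg (by omega)]
      · unfold ext0; rw [dif_neg hn]
    rw [JM_pow_succ, JM_action z hz (fun l => (JM z ^ k) l ⟨0, hN⟩), if_neg (by omega), h1,
      ih' i (by omega) i.2, ih' (i - 1) (by omega) (by omega), if_neg (by omega)]
    by_cases h : (i : ℕ) = k + 1
    · rw [if_pos (by omega), if_pos h, h, dd, dd, prod_range_succ,
        show 2 * (k + 1) - 1 = 2 * k + 1 by omega, show k + 1 - 1 = k by omega]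
      ring
    · rw [if_neg (by omega), if_neg h]; ring

lemma JM_symm {N : ℕ} (z : Fin (2 * N - 1) → ℝ) (k : ℕ) : (JM z ^ k)ᵀ = JM z ^ k := by
  rw [Matrix.transpose_pow]
  congr 1
  have := jacobiMatrix_isHermitian (xiToA z) (xiToB z)
  rwa [Matrix.IsHermitian, conjTranspose_eq_transpose_of_trivial] at this

lemma JM_hankel {N : ℕ} (hN : 0 < N) (z : Fin (2 * N - 1) → ℝ) (hz : ∀ i, 0 ≤ z i) :
    (Matrix.of fun a b : Fin N => (JM z ^ ((a : ℕ) + (b : ℕ))) ⟨0, hN⟩ ⟨0, hN⟩).det =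
      (∏ n ∈ range N, dd z n) ^ 2 := by
  set K : Matrix (Fin N) (Fin N) ℝ := Matrix.of fun n k => (JM z ^ (k : ℕ)) n ⟨0, hN⟩ with hK
  have h1 : (Matrix.of fun a b : Fin N => (JM z ^ ((a : ℕ) + (b : ℕ))) ⟨0, hN⟩ ⟨0, hN⟩) =
      Kᵀ * K := by
    ext a b
    rw [of_apply, pow_add, Matrix.mul_apply, Matrix.mul_apply]
    refine sum_congr rfl fun n _ => ?_
    rw [← JM_symm z a, transpose_apply, transpose_apply, hK, of_apply, of_apply]
  have h2 : K.det = ∏ n ∈ range N, dd z n := by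
    rw [Matrix.det_of_isUpperTriangular, ← Fin.prod_univ_eq_prod_range]
    · refine prod_congr rfl fun n _ => ?_
      rw [hK, of_apply, JM_tri hN z hz n n le_rfl, if_pos rfl]
    · intro i j hij
      have hij' : j < i := hij
      rw [hK, of_apply, JM_tri hN z hz j i (Fin.le_def.1 hij'.le), if_neg]
      have := Fin.lt_def.1 hij'
      omega
  rw [h1, det_mul, det_transpose, h2, sq]

lemma JM_det {N : ℕ} (z : Fin (2 * N - 1) → ℝ) (hz : ∀ i, 0 ≤ z i) :
    (JM z).det = ∏ n ∈ range N, ext0 z (2 * n) := by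
  have : (bidiag z).det = ∏ n ∈ range N, √(ext0 z (2 * n)) := by
    rw [Matrix.det_of_isLowerTriangular, ← Fin.prod_univ_eq_prod_range (fun n => √(ext0 z (2 * n)))]
    · refine prod_congr rfl fun n _ => ?_
      rw [bidiag_apply]; simp
    · intro i j hij
      have hij' : i < j := hij
      have := Fin.lt_def.1 hij'
      rw [bidiag_apply, if_neg (by omega), if_neg (by omega), add_zero]
  rw [JM_eq z hz, det_mul, det_transpose, this, ← prod_mul_distrib]
  exact prod_congr rfl fun n _ => Real.mul_self_sqrt (ext0_nonneg hz _)

lemma sum_range_odd (f : ℕ → ℝ) (n : ℕ) : ∑ i ∈ range (2 * n + 1), f i =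
    ∑ i ∈ range (n + 1), if i = 0 then f 0 else f (2 * i - 1) + f (2 * i) := by
  induction n with
  | zero => simp
  | succ n ih =>
    rw [sum_range_succ _ (n + 1), ← ih, show 2 * (n + 1) + 1 = 2 * n + 1 + 1 + 1 by ring,
      sum_range_succ, sum_range_succ, if_neg (by omega), show 2 * (n + 1) - 1 = 2 * n + 1 by omega,
      show 2 * (n + 1) = 2 * n + 1 + 1 by ring]
    ring

lemma JM_trace {N : ℕ} (hN : 0 < N) (z : Fin (2 * N - 1) → ℝ) :
    (JM z).trace = ∑ i, z i := by
  obtain ⟨n, rfl⟩ : ∃ n, N = n + 1 := ⟨N - 1, by omega⟩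
  have h1 : ∑ i, z i = ∑ i ∈ range (2 * n + 1), ext0 z i := by
    rw [show 2 * n + 1 = 2 * (n + 1) - 1 by omega, ← Fin.sum_univ_eq_sum_range]
    exact sum_congr rfl fun i _ => (ext0_apply z i).symm
  rw [h1, sum_range_odd, ← Fin.sum_univ_eq_sum_range (fun i => if i = 0 then ext0 z 0 else
    ext0 z (2 * i - 1) + ext0 z (2 * i))]
  unfold Matrix.trace
  refine sum_congr rfl fun i _ => ?_
  simp only [diag_apply, JM, jacobiMatrix, of_apply, xiToA, if_true]
  by_cases h : (i : ℕ) = 0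
  · rw [dif_pos h, if_pos h, ext0_of_lt]
  · rw [dif_neg h, if_neg h, ext0_of_lt, ext0_of_lt]
end

section

lemma hermitian_pow_apply {N : ℕ} {A : Matrix (Fin N) (Fin N) ℝ} (hA : A.IsHermitian) (k : ℕ)
    (o : Fin N) : (A ^ k) o o = ∑ i, (hA.eigenvectorBasis i o) ^ 2 * hA.eigenvalues i ^ k := by
  conv_lhs => rw [hA.spectral_theorem, ← map_pow, Unitary.conjStarAlgAut_apply]
  rw [Matrix.mul_apply]
  refine sum_congr rfl fun i _ => ?_
  rw [diagonal_pow, Matrix.mul_diagonal, Matrix.star_apply, 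
    Matrix.IsHermitian.eigenvectorUnitary_apply]
  simp
  ring

/-- The sorting permutation. -/
def sortPerm {N : ℕ} (v : Fin N → ℝ) : Equiv.Perm (Fin N) := Fin.revPerm.trans (Tuple.sort v)

lemma jacobi_moment {N : ℕ} (hN : 0 < N) (a : Fin N → ℝ) (b : Fin (N - 1) → ℝ) (k : ℕ) :
    (jacobiMatrix a b ^ k) ⟨0, hN⟩ ⟨0, hN⟩ =
      ∑ i, jacobiWeights hN a b i * jacobiEigs a b i ^ k := by
  rw [hermitian_pow_apply (jacobiMatrix_isHermitian a b)]
  exact (Equiv.sum_comp (sortPerm (jacobiMatrix_isHermitian a b).eigenvalues) (fun i =>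
    ((jacobiMatrix_isHermitian a b).eigenvectorBasis i ⟨0, hN⟩) ^ 2 *
      (jacobiMatrix_isHermitian a b).eigenvalues i ^ k)).symm

lemma jacobiEigs_antitone {N : ℕ} (a : Fin N → ℝ) (b : Fin (N - 1) → ℝ) :
    Antitone (jacobiEigs a b) := by
  intro i j hij
  exact Tuple.monotone_sort (jacobiMatrix_isHermitian a b).eigenvalues (Fin.rev_le_rev.2 hij)

lemma prod_jacobiEigs {N : ℕ} (a : Fin N → ℝ) (b : Fin (N - 1) → ℝ) :
    ∏ i, jacobiEigs a b i = (jacobiMatrix a b).det := by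
  have := (jacobiMatrix_isHermitian a b).det_eq_prod_eigenvalues
  rw [this]
  exact Equiv.prod_comp (sortPerm (jacobiMatrix_isHermitian a b).eigenvalues) (fun i =>
      (jacobiMatrix_isHermitian a b).eigenvalues i)

lemma sum_jacobiEigs {N : ℕ} (a : Fin N → ℝ) (b : Fin (N - 1) → ℝ) :
    ∑ i, jacobiEigs a b i = (jacobiMatrix a b).trace := by
  have := (jacobiMatrix_isHermitian a b).trace_eq_sum_eigenvalues
  rw [this]
  exact Equiv.sum_comp (sortPerm (jacobiMatrix_isHermitian a b).eigenvalues) (fun i =>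
      (jacobiMatrix_isHermitian a b).eigenvalues i)

lemma jacobiEigs_nonneg {N : ℕ} (z : Fin (2 * N - 1) → ℝ) (hz : ∀ i, 0 ≤ z i) (i : Fin N) :
    0 ≤ jacobiEigs (xiToA z) (xiToB z) i := by
  have h : (JM z).PosSemidef := by
    rw [JM_eq z hz]
    have := Matrix.posSemidef_self_mul_conjTranspose (bidiag z)
    rwa [conjTranspose_eq_transpose_of_trivial] at this
  exact h.eigenvalues_nonneg _

lemma vdm_ne_zero_iff {N : ℕ} (x : Fin N → ℝ) : vdm x ≠ 0 ↔ Function.Injective x := by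
  have := Matrix.det_vandermonde_ne_zero_iff (v := x)
  rwa [Matrix.det_vandermonde] at this

variable {N : ℕ}

/-- Tail. -/
def tl (z : Fin (2 * N - 1 + 1) → ℝ) : Fin (2 * N - 1) → ℝ := fun i => z i.succ

lemma ext0_tl (z : Fin (2 * N - 1 + 1) → ℝ) (n : ℕ) : ext0 z (n + 1) = ext0 (tl z) n := by
  unfold ext0 tl
  by_cases h : n < 2 * N - 1
  · rw [dif_pos h, dif_pos (by omega)]; rfl
  · rw [dif_neg h, dif_neg (by omega)]

lemma hmN (hN : 0 < N) : N + N = 2 * N - 1 + 1 := by omega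

/-- Spectral data. -/
def Smap (hN : 0 < N) (z : Fin (2 * N - 1 + 1) → ℝ) : Fin (2 * N - 1 + 1) → ℝ := fun k =>
  Sum.elim (fun i => jacobiEigs (xiToA (tl z)) (xiToB (tl z)) i)
    (fun i => z 0 * jacobiWeights hN (xiToA (tl z)) (xiToB (tl z)) i) ((eIdx (hmN hN)).symm k)

lemma xP_Smap (hN : 0 < N) (z : Fin (2 * N - 1 + 1) → ℝ) :
    xP (hmN hN) (Smap hN z) = jacobiEigs (xiToA (tl z)) (xiToB (tl z)) := by
  funext i; simp [xP, Smap]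

lemma wP_Smap (hN : 0 < N) (z : Fin (2 * N - 1 + 1) → ℝ) :
    wP (hmN hN) (Smap hN z) = fun i => z 0 * jacobiWeights hN (xiToA (tl z)) (xiToB (tl z)) i := by
  funext i; simp [wP, Smap]

lemma mom_eq_JM (hN : 0 < N) (z : Fin (2 * N - 1 + 1) → ℝ) (hz : ∀ i, 0 ≤ z i) (k : ℕ) :
    mom (ext0 z) k = z 0 * (JM (tl z) ^ k) ⟨0, hN⟩ ⟨0, hN⟩ := by
  have h := JM_dyck hN (tl z) (fun i => hz _) (ext0 z) (ext0_tl z) k ⟨0, hN⟩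
  simp only [dd, range_zero, prod_empty, one_mul, mul_zero] at h
  rw [mom, h, ext0_of_lt z (by omega)]; rfl

lemma mom_eq_sum (hN : 0 < N) (z : Fin (2 * N - 1 + 1) → ℝ) (hz : ∀ i, 0 ≤ z i) (k : ℕ) :
    mom (ext0 z) k = ∑ i, wP (hmN hN) (Smap hN z) i * xP (hmN hN) (Smap hN z) i ^ k := by
  rw [mom_eq_JM hN z hz, jacobi_moment, mul_sum, wP_Smap, xP_Smap]
  exact sum_congr rfl fun i _ => by ring

lemma Pmap_Smap (hN : 0 < N) (z : Fin (2 * N - 1 + 1) → ℝ) (hz : ∀ i, 0 ≤ z i) :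
    Pmap (hmN hN) (Smap hN z) = Mmap z := by
  funext k
  exact (mom_eq_sum hN z hz k).symm

/-- The Hankel identity. -/
lemma hankel_of_Pmap_eq (hN : 0 < N) (z y : Fin (2 * N - 1 + 1) → ℝ) (hz : ∀ i, 0 ≤ z i)
    (h : Pmap (hmN hN) y = Mmap z) :
    (∏ i, wP (hmN hN) y i) * vdm (xP (hmN hN) y) ^ 2 =
      z 0 ^ N * (∏ n ∈ range N, dd (tl z) n) ^ 2 := by
  rw [← hankel_det, ← JM_hankel hN (tl z) (fun i => hz _)]
  have : (Matrix.of fun a b : Fin N =>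
      ∑ i, wP (hmN hN) y i * xP (hmN hN) y i ^ ((a : ℕ) + (b : ℕ))) = z 0 •
      (Matrix.of fun a b : Fin N => (JM (tl z) ^ ((a : ℕ) + (b : ℕ))) ⟨0, hN⟩ ⟨0, hN⟩) := by
    ext a b
    simp only [of_apply, Matrix.smul_apply, smul_eq_mul]
    rw [← mom_eq_JM hN z hz]
    exact congrFun h ⟨(a : ℕ) + b, by omega⟩
  rw [this, det_smul, Fintype.card_fin]

lemma Smap_mem_W0 (hN : 0 < N) (z : Fin (2 * N - 1 + 1) → ℝ) (hz : ∀ i, 0 ≤ z i)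
    (h : z 0 ^ N * (∏ n ∈ range N, dd (tl z) n) ^ 2 ≠ 0) : Smap hN z ∈ W0 (hmN hN) := by
  rw [← hankel_of_Pmap_eq hN z _ hz (Pmap_Smap hN z hz)] at h
  have h1 := left_ne_zero_of_mul h
  have h2 : vdm (xP (hmN hN) (Smap hN z)) ≠ 0 := fun h' => h (by rw [h']; simp)
  rw [vdm_ne_zero_iff] at h2
  refine ⟨?_, fun i => ?_⟩
  · intro i j hij
    rw [xP_Smap] at h2 ⊢
    exact lt_of_le_of_ne (jacobiEigs_antitone _ _ hij.le) (fun h' => hij.ne' (h2 h'))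
  · have h3 := (prod_ne_zero_iff.1 h1) i (mem_univ i)
    refine lt_of_le_of_ne ?_ h3.symm
    rw [wP_Smap]
    exact mul_nonneg (hz 0) (sq_nonneg _)

/-- Positive parameters. -/
def Uset (m : ℕ) : Set (Fin m → ℝ) := {z | ∀ i, 0 < z i}

/-- Positive spectral data. -/
def Wset (hN : 0 < N) : Set (Fin (2 * N - 1 + 1) → ℝ) :=
  {y | y ∈ W0 (hmN hN) ∧ ∀ i, 0 < xP (hmN hN) y i}

lemma dd_pos (z : Fin (2 * N - 1 + 1) → ℝ) (hz : z ∈ Uset _) (n : ℕ) (hn : n < N) :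
    0 < dd (tl z) n := by
  refine prod_pos fun i hi => ?_
  have := mem_range.1 hi
  rw [ext0_of_lt _ (by omega), ext0_of_lt _ (by omega)]
  exact mul_pos (Real.sqrt_pos.2 (hz _)) (Real.sqrt_pos.2 (hz _))

lemma Smap_mem (hN : 0 < N) (z : Fin (2 * N - 1 + 1) → ℝ) (hz : z ∈ Uset _) :
    Smap hN z ∈ Wset hN := by
  have hz' : ∀ i, 0 ≤ z i := fun i => (hz i).le
  refine ⟨Smap_mem_W0 hN z hz' ?_, fun i => ?_⟩
  · refine mul_ne_zero (pow_ne_zero _ (hz 0).ne') (pow_ne_zero _ (prod_ne_zero_iff.2 fun n hn => ?_))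
    exact (dd_pos z hz n (mem_range.1 hn)).ne'
  · rw [xP_Smap]
    have h1 := prod_jacobiEigs (xiToA (tl z)) (xiToB (tl z))
    rw [JM_det (tl z) (fun i => hz' _)] at h1
    have h2 : ∏ n ∈ range N, ext0 (tl z) (2 * n) ≠ 0 := prod_ne_zero_iff.2 fun n hn => by
      have := mem_range.1 hn
      rw [ext0_of_lt _ (by omega)]; exact (hz _).ne'
    rw [← h1] at h2
    exact lt_of_le_of_ne (jacobiEigs_nonneg _ (fun i => hz' _) i)
      ((prod_ne_zero_iff.1 h2) i (mem_univ i)).symm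

lemma mem_U_of_Pmap_eq (hN : 0 < N) (z y : Fin (2 * N - 1 + 1) → ℝ) (hz : ∀ i, 0 ≤ z i)
    (hy : y ∈ Wset hN) (h : Pmap (hmN hN) y = Mmap z) : z ∈ Uset _ ∧ Smap hN z = y := by
  have hpos : (∏ i, wP (hmN hN) y i) * vdm (xP (hmN hN) y) ^ 2 ≠ 0 :=
    mul_ne_zero (prod_ne_zero_iff.2 fun i _ => (hy.1.2 i).ne')
      (pow_ne_zero _ ((vdm_ne_zero_iff _).2 (chamber_inj hy.1.1)))
  rw [hankel_of_Pmap_eq hN z y hz h] at hpos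
  have hS : Smap hN z = y := Pmap_injOn (hmN hN) (Smap_mem_W0 hN z hz hpos) hy.1
    ((Pmap_Smap hN z hz).trans h.symm)
  refine ⟨fun i => lt_of_le_of_ne (hz i) (Ne.symm ?_), hS⟩
  have hz0 : z 0 ≠ 0 := by
    have := left_ne_zero_of_mul hpos
    exact fun h' => this (by rw [h', zero_pow hN.ne'])
  have hev : ∀ n < N, ext0 (tl z) (2 * n) ≠ 0 := by
    have h1 := prod_jacobiEigs (xiToA (tl z)) (xiToB (tl z))
    rw [JM_det (tl z) (fun i => hz _), ← xP_Smap hN z, hS] at h1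
    have h2 : ∏ i, xP (hmN hN) y i ≠ 0 := prod_ne_zero_iff.2 fun i _ => (hy.2 i).ne'
    rw [h1] at h2
    exact fun n hn => (prod_ne_zero_iff.1 h2) n (mem_range.2 hn)
  have hod : ∀ n, n + 1 < N → ext0 (tl z) (2 * n + 1) ≠ 0 := by
    intro n hn
    have h1 : (∏ n ∈ range N, dd (tl z) n) ≠ 0 := by
      have := right_ne_zero_of_mul hpos
      exact fun h' => this (by rw [h']; simp)
    have h2 := (prod_ne_zero_iff.1 h1) (n + 1) (mem_range.2 hn)
    have h3 := (prod_ne_zero_iff.1 h2) n (mem_range.2 (by omega))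
    intro h'
    rw [h'] at h3
    simp at h3
  refine Fin.cases hz0 (fun j => ?_) i
  have hj := j.2
  have h1 : ext0 (tl z) j ≠ 0 := by
    rcases Nat.even_or_odd' (j : ℕ) with ⟨c, hc | hc⟩
    · rw [hc]; exact hev c (by omega)
    · rw [hc]; exact hod c (by omega)
  rwa [ext0_apply] at h1

lemma chamber_isOpen (N : ℕ) : IsOpen (chamber N) := by
  have : chamber N = ⋂ i, ⋂ j, ⋂ (_ : i < j), {x : Fin N → ℝ | x j < x i} := by
    ext x; simp [chamber]
  rw [this]
  exact isOpen_iInter_of_finite fun i => isOpen_iInter_of_finite fun j =>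
    isOpen_iInter_of_finite fun _ => isOpen_lt (continuous_apply j) (continuous_apply i)

lemma continuous_xP {m : ℕ} (hm : N + N = m) : Continuous (xP hm) := by unfold xP; fun_prop
lemma continuous_wP {m : ℕ} (hm : N + N = m) : Continuous (wP hm) := by unfold wP; fun_prop

lemma Uset_isOpen (m : ℕ) : IsOpen (Uset m) := by
  have : Uset m = ⋂ i, {z : Fin m → ℝ | 0 < z i} := by ext; simp [Uset]
  rw [this]
  exact isOpen_iInter_of_finite fun i => isOpen_lt continuous_const (continuous_apply i)

lemma Wset_isOpen (hN : 0 < N) : IsOpen (Wset hN) := by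
  have : Wset hN = (xP (hmN hN)) ⁻¹' (chamber N) ∩ (wP (hmN hN)) ⁻¹' (Uset N) ∩
      (xP (hmN hN)) ⁻¹' (Uset N) := by
    ext y; simp [Wset, W0, Uset]
  rw [this]
  exact (((chamber_isOpen N).preimage (continuous_xP _)).inter
    ((Uset_isOpen N).preimage (continuous_wP _))).inter ((Uset_isOpen N).preimage (continuous_xP _))

lemma Wset_convex (hN : 0 < N) : Convex ℝ (Wset hN) := by
  intro y hy y' hy' a b ha hb hab
  have key : ∀ s t s' t' : ℝ, s < t → s' < t' → a * s + b * s' < a * t + b * t' := by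
    intro s t s' t' h h'
    rcases ha.lt_or_eq with ha' | ha'
    · nlinarith [mul_lt_mul_of_pos_left h ha', mul_le_mul_of_nonneg_left h'.le hb]
    · obtain rfl : b = 1 := by linarith
      rw [← ha']; linarith
  refine ⟨⟨fun i j hij => ?_, fun i => ?_⟩, fun i => ?_⟩
  · exact key _ _ _ _ (hy.1.1 i j hij) (hy'.1.1 i j hij)
  · have := key _ _ _ _ (hy.1.2 i) (hy'.1.2 i)
    simpa [wP] using this
  · have := key _ _ _ _ (hy.2 i) (hy'.2 i)
    simpa [xP] using this

lemma Wset_subset (hN : 0 < N) : Wset hN ⊆ (Pmap (hmN hN)) ⁻¹' (Mmap '' Uset _) := by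
  have hPc : Continuous (Pmap (hmN hN)) := (contDiff_Pmap _).continuous
  have hMc : Continuous (Mmap (m := 2 * N - 1 + 1)) := (contDiff_Mmap _).continuous
  set u : Set (Fin (2 * N - 1 + 1) → ℝ) := Wset hN ∩ (Pmap (hmN hN)) ⁻¹' (Mmap '' Uset _) with hu
  have huo : IsOpen u := (Wset_isOpen hN).inter (Mmap_isOpen_image.preimage hPc)
  have hmain : Wset hN ⊆ u := by
    refine (Wset_convex hN).isPreconnected.subset_of_closure_inter_subset huo ?_ ?_
    · refine ⟨Smap hN (fun _ => 1), ?_⟩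
      have h1 : (fun _ => 1 : Fin (2 * N - 1 + 1) → ℝ) ∈ Uset _ := fun _ => one_pos
      have h2 := Smap_mem hN _ h1
      exact ⟨h2, h2, _, h1, (Pmap_Smap hN _ (fun i => (h1 i).le)).symm⟩
    · rintro y ⟨hyc, hyW⟩
      refine ⟨hyW, ?_⟩
      obtain ⟨ys, hys, hlim⟩ := mem_closure_iff_seq_limit.1 hyc
      choose hysW zs hzsU hzs using hys
      have hS : ∀ n, Smap hN (zs n) = ys n := fun n =>
        (mem_U_of_Pmap_eq hN (zs n) (ys n) (fun i => (hzsU n i).le) (hysW n) (hzs n).symm).2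
      have hsum : ∀ n, ∑ i, zs n i = Pmap (hmN hN) (ys n) 0 + ∑ i, xP (hmN hN) (ys n) i := by
        intro n
        rw [← hzs n, ← hS n, xP_Smap, sum_jacobiEigs, JM_trace hN, Fin.sum_univ_succ]
        congr 1
        change _ = mom _ _
        rw [Fin.val_zero, mom_zero]; exact (ext0_apply (zs n) 0).symm
      have hcont : Continuous (fun y => Pmap (hmN hN) y 0 + ∑ i, xP (hmN hN) y i) := by
        have := continuous_xP (hmN hN)
        fun_prop
      obtain ⟨R, hR⟩ := ((hcont.tendsto y).comp hlim).bddAbove_range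
      have hbd : ∀ n, zs n ∈ Set.Icc (0 : Fin (2 * N - 1 + 1) → ℝ) (fun _ => R) := by
        intro n
        refine ⟨fun i => (hzsU n i).le, fun i => ?_⟩
        have h1 : zs n i ≤ ∑ i, zs n i :=
          single_le_sum (fun j _ => (hzsU n j).le) (mem_univ i)
        have h2 := hR ⟨n, rfl⟩
        simp only [Function.comp] at h2
        rw [← hsum] at h2
        exact h1.trans h2
      obtain ⟨z, hz, φ, hφ, hφl⟩ := isCompact_Icc.tendsto_subseq hbd
      have hMz : Mmap z = Pmap (hmN hN) y := by
        have h1 := (hMc.tendsto z).comp hφl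
        have h2 := (hPc.tendsto y).comp (hlim.comp hφ.tendsto_atTop)
        refine tendsto_nhds_unique h1 (h2.congr fun n => ?_)
        exact (hzs _).symm
      exact ⟨z, (mem_U_of_Pmap_eq hN z y (fun i => hz.1 i) hyW hMz.symm).1, hMz⟩
  exact hmain.trans Set.inter_subset_right

lemma image_eq (hN : 0 < N) : Mmap '' Uset _ = Pmap (hmN hN) '' Wset hN := by
  ext v
  constructor
  · rintro ⟨z, hz, rfl⟩
    exact ⟨_, Smap_mem hN z hz, Pmap_Smap hN z fun i => (hz i).le⟩
  · rintro ⟨y, hy, rfl⟩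
    exact Wset_subset hN hy
end

section

/-- Gamma shapes. -/
def sh (N : ℕ) (β k : ℝ) (j : ℕ) : ℝ :=
  if j % 2 = 0 then β / 2 * ((N : ℝ) - (j : ℝ) / 2)
  else β / 2 * ((N : ℝ) - (((j : ℝ) - 1) / 2 + 1)) + k

/-- Gamma rates. -/
def rt (θ : ℝ) (j : ℕ) : ℝ := if j = 0 then 1 else θ⁻¹

lemma sh_even (N : ℕ) (β k : ℝ) (i : ℕ) : sh N β k (2 * i) = β / 2 * ((N : ℝ) - i) := by
  rw [sh, if_pos (by omega)]; push_cast; ring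

lemma sh_odd (N : ℕ) (β k : ℝ) (i : ℕ) :
    sh N β k (2 * i + 1) = β / 2 * ((N : ℝ) - i - 1) + k := by
  rw [sh, if_neg (by omega)]; push_cast; ring

lemma sh_pos (N : ℕ) (β k : ℝ) (hβ : 0 < β) (hk : 0 < k) (j : ℕ) (hj : j < 2 * N) :
    0 < sh N β k j := by
  rcases Nat.even_or_odd' j with ⟨c, rfl | rfl⟩
  · rw [sh_even]
    have : (c : ℝ) < N := by exact_mod_cast (by omega : c < N)
    exact mul_pos (by linarith) (by linarith)
  · rw [sh_odd]
    have : (c : ℝ) + 1 ≤ N := by exact_mod_cast (by omega : c + 1 ≤ N)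
    have : 0 ≤ β / 2 * ((N : ℝ) - c - 1) := mul_nonneg (by linarith) (by linarith)
    linarith

lemma rt_pos (θ : ℝ) (hθ : 0 < θ) (j : ℕ) : 0 < rt θ j := by
  unfold rt; split_ifs; exacts [one_pos, inv_pos.2 hθ]

lemma sum_tri (L : ℕ → ℝ) (N : ℕ) : ∑ k ∈ range (2 * N), ∑ n ∈ range k, L n =
    2 * ∑ n ∈ range N, ∑ j ∈ range (2 * n + 1), L j - ∑ n ∈ range N, L (2 * n) := by
  induction N with
  | zero => simp
  | succ N ih =>
    rw [show 2 * (N + 1) = 2 * N + 1 + 1 by ring, sum_range_succ, sum_range_succ, ih,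
      sum_range_succ _ N, sum_range_succ _ N, sum_range_succ _ (2 * N)]
    ring

lemma sum_two (L : ℕ → ℝ) (N : ℕ) : ∑ j ∈ range (2 * N), L j =
    ∑ n ∈ range N, (L (2 * n) + L (2 * n + 1)) := by
  induction N with
  | zero => simp
  | succ N ih =>
    rw [show 2 * (N + 1) = 2 * N + 1 + 1 by ring, sum_range_succ, sum_range_succ, ih,
      sum_range_succ _ N]
    ring

lemma sum_D (L : ℕ → ℝ) (N : ℕ) : ∑ n ∈ range N, ∑ j ∈ range (2 * n + 1), L j =
    ∑ i ∈ range N, (((N : ℝ) - i) * L (2 * i) + ((N : ℝ) - i - 1) * L (2 * i + 1)) := by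
  induction N with
  | zero => simp
  | succ N ih =>
    rw [sum_range_succ, ih, sum_range_succ, sum_range_succ, sum_two]
    push_cast
    rw [← add_assoc, ← sum_add_distrib]
    have : ∀ i ∈ range N, (((N : ℝ) + 1 - i) * L (2 * i) + ((N : ℝ) + 1 - i - 1) * L (2 * i + 1))
      = (((N : ℝ) - i) * L (2 * i) + ((N : ℝ) - i - 1) * L (2 * i + 1)) + (L (2 * i) + L (2 * i + 1)) := 
      fun i _ => by ring
    rw [sum_congr rfl this]
    ring

variable {N : ℕ}

lemma log_D (z : Fin (2 * N - 1 + 1) → ℝ) (hz : z ∈ Uset _) (hN : 0 < N) :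
    Real.log (z 0 ^ N * (∏ n ∈ range N, dd (tl z) n) ^ 2) =
      ∑ n ∈ range N, ∑ j ∈ range (2 * n + 1), Real.log (ext0 z j) := by
  have hdd : ∀ n ∈ range N, dd (tl z) n ≠ 0 := fun n hn => (dd_pos z hz n (mem_range.1 hn)).ne'
  have h1 : ∀ n ∈ range N, 2 * Real.log (dd (tl z) n) =
      ∑ j ∈ range (2 * n), Real.log (ext0 z (j + 1)) := by
    intro n hn
    have hn' := mem_range.1 hn
    have hp : ∀ i ∈ range n, 0 < ext0 (tl z) (2 * i) ∧ 0 < ext0 (tl z) (2 * i + 1) := by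
      intro i hi
      have := mem_range.1 hi
      rw [ext0_of_lt _ (by omega), ext0_of_lt _ (by omega)]
      exact ⟨hz _, hz _⟩
    rw [dd, Real.log_prod (fun i hi => (mul_pos (Real.sqrt_pos.2 (hp i hi).1)
      (Real.sqrt_pos.2 (hp i hi).2)).ne'), sum_two, mul_sum]
    refine sum_congr rfl fun i hi => ?_
    rw [Real.log_mul (Real.sqrt_pos.2 (hp i hi).1).ne' (Real.sqrt_pos.2 (hp i hi).2).ne',
      Real.log_sqrt (hp i hi).1.le, Real.log_sqrt (hp i hi).2.le, ext0_tl, ext0_tl]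
    ring
  rw [Real.log_mul (pow_ne_zero _ (hz 0).ne') (pow_ne_zero _ (prod_ne_zero_iff.2 hdd)),
    Real.log_pow, Real.log_pow, Real.log_prod hdd, Nat.cast_two, mul_sum, sum_congr rfl h1]
  simp_rw [sum_range_succ' _ (2 * _)]
  rw [sum_add_distrib, sum_const, card_range, nsmul_eq_mul, ext0_of_lt z (by omega)]
  exact add_comm _ _

/-- Laguerre density. -/
def Fden (β k θ : ℝ) (x : Fin N → ℝ) : ℝ :=
  |vdm x| ^ β * ∏ n : Fin N, (x n ^ (k - 1) * Real.exp (-(x n) / θ))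

/-- Weight density. -/
def qden (β : ℝ) (w : Fin N → ℝ) : ℝ := ∏ n : Fin N, (w n ^ (β / 2 - 1) * Real.exp (-(w n)))

/-- The Jacobian of `Pmap`. -/
def Pdet (hN : 0 < N) (y : Fin (2 * N - 1 + 1) → ℝ) : ℝ :=
  |∏ i, wP (hmN hN) y i| * vdm (xP (hmN hN) y) ^ 4

lemma Pdet_pos (hN : 0 < N) (y : Fin (2 * N - 1 + 1) → ℝ) (hy : y ∈ Wset hN) : 0 < Pdet hN y := by
  refine mul_pos (abs_pos.2 (prod_ne_zero_iff.2 fun i _ => (hy.1.2 i).ne')) ?_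
  have := (vdm_ne_zero_iff _).2 (chamber_inj hy.1.1)
  positivity

lemma density_identity (hN : 0 < N) (β k θ : ℝ) 
    (z : Fin (2 * N - 1 + 1) → ℝ) (hz : z ∈ Uset _) :
    Mdet z * (Fden β k θ (xP (hmN hN) (Smap hN z)) * qden β (wP (hmN hN) (Smap hN z)) /
      Pdet hN (Smap hN z)) =
    ∏ j, (z j ^ (sh N β k j - 1) * Real.exp (-(rt θ j * z j))) := by
  have hz' : ∀ i, 0 ≤ z i := fun i => (hz i).le
  have hy := Smap_mem hN z hz
  have hPM := Pmap_Smap hN z hz'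
  have hD := log_D z hz hN
  rw [← hankel_of_Pmap_eq hN z _ hz' hPM] at hD
  have hsum : ∑ i, xP (hmN hN) (Smap hN z) i = ∑ i, tl z i := by
    rw [xP_Smap, sum_jacobiEigs, ← JM_trace hN]
  have hprod : ∏ i, xP (hmN hN) (Smap hN z) i = ∏ n ∈ range N, ext0 z (2 * n + 1) := by
    rw [xP_Smap, prod_jacobiEigs]
    simp_rw [ext0_tl]
    exact JM_det (tl z) (fun i => hz' _)
  have hw : ∑ i, wP (hmN hN) (Smap hN z) i = z 0 := by
    have := mom_eq_sum hN z hz' 0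
    rw [mom_zero, ext0_of_lt z (by omega)] at this
    simpa using this.symm
  set x := xP (hmN hN) (Smap hN z) with hx
  set w := wP (hmN hN) (Smap hN z) with hwd
  have hxp : ∀ i, 0 < x i := hy.2
  have hwp : ∀ i, 0 < w i := hy.1.2
  have hv : vdm x ≠ 0 := (vdm_ne_zero_iff _).2 (chamber_inj hy.1.1)
  have hva : 0 < |vdm x| := abs_pos.2 hv
  have hM := Mdet_pos z hz
  have hPd := Pdet_pos hN _ hy
  have hF : 0 < Fden β k θ x := mul_pos (Real.rpow_pos_of_pos hva _)
    (prod_pos fun n _ => mul_pos (Real.rpow_pos_of_pos (hxp n) _) (Real.exp_pos _))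
  have hq : 0 < qden β w := 
    (prod_pos fun n _ => mul_pos (Real.rpow_pos_of_pos (hwp n) _) (Real.exp_pos _))
  have hzp : ∀ j, 0 < z j ^ (sh N β k j - 1) * Real.exp (-(rt θ j * z j)) := fun j =>
    mul_pos (Real.rpow_pos_of_pos (hz j) _) (Real.exp_pos _)
  have hwprod : 0 < ∏ i, w i := prod_pos fun i _ => hwp i
  have lF : Real.log (Fden β k θ x) = β * Real.log |vdm x| +
      ((k - 1) * Real.log (∏ i, x i) - (∑ i, x i) / θ) := by
    rw [Fden, Real.log_mul (Real.rpow_pos_of_pos hva _).ne' (prod_pos fun n _ =>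
      mul_pos (Real.rpow_pos_of_pos (hxp n) _) (Real.exp_pos _)).ne', Real.log_rpow hva,
      Real.log_prod fun n _ => (mul_pos (Real.rpow_pos_of_pos (hxp n) _) (Real.exp_pos _)).ne',
      Real.log_prod fun n _ => (hxp n).ne', mul_sum, sum_div, ← sum_sub_distrib]
    congr 1
    refine sum_congr rfl fun n _ => ?_
    rw [Real.log_mul (Real.rpow_pos_of_pos (hxp n) _).ne' (Real.exp_pos _).ne', Real.log_exp,
      Real.log_rpow (hxp n)]
    ring
  have lq : Real.log (qden β w) = (β / 2 - 1) * Real.log (∏ i, w i) - ∑ i, w i := by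
    rw [qden, 
      Real.log_prod fun n _ => (mul_pos (Real.rpow_pos_of_pos (hwp n) _) (Real.exp_pos _)).ne',
      Real.log_prod fun n _ => (hwp n).ne', mul_sum, ← sum_sub_distrib]
    refine sum_congr rfl fun n _ => ?_
    rw [Real.log_mul (Real.rpow_pos_of_pos (hwp n) _).ne' (Real.exp_pos _).ne', Real.log_exp,
      Real.log_rpow (hwp n)]
    ring
  have lP : Real.log (Pdet hN (Smap hN z)) = Real.log (∏ i, w i) + 4 * Real.log |vdm x| := by
    rw [Pdet, ← hx, ← hwd, abs_of_pos hwprod, Real.log_mul hwprod.ne' (pow_ne_zero _ hv),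
      Real.log_pow, Real.log_abs]
    norm_num
  have lD : Real.log (∏ i, w i) + 2 * Real.log |vdm x| =
      ∑ n ∈ range N, ∑ j ∈ range (2 * n + 1), Real.log (ext0 z j) := by
    rw [← hD, Real.log_mul hwprod.ne' (pow_ne_zero _ hv), Real.log_pow, Real.log_abs]
    norm_num
  have hep : ∀ n, n < 2 * N → ext0 z n ≠ 0 := fun n hn => by
    rw [ext0_of_lt z (by omega)]; exact (hz _).ne'
  have hr2 : range (2 * N - 1 + 1) = range (2 * N) := by congr 1; omega
  have lM : Real.log (Mdet z) = ∑ k ∈ range (2 * N), ∑ n ∈ range k, Real.log (ext0 z n) := by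
    rw [Mdet, hr2, Real.log_prod fun k hk => prod_ne_zero_iff.2 
      fun n hn => hep n (by have := mem_range.1 hk; have := mem_range.1 hn; omega)]
    exact sum_congr rfl fun k hk => Real.log_prod fun n hn => 
      hep n (by have := mem_range.1 hk; have := mem_range.1 hn; omega)
  have lX : Real.log (∏ i, x i) = ∑ n ∈ range N, Real.log (ext0 z (2 * n + 1)) := by
    rw [hprod, Real.log_prod fun n hn => hep _ (by have := mem_range.1 hn; omega)]
  have hrt : ∑ j : Fin (2 * N - 1 + 1), rt θ j * z j = z 0 + (∑ i, tl z i) / θ := by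
    rw [Fin.sum_univ_succ, sum_div]
    congr 1
    · simp [rt]
    · refine sum_congr rfl fun i _ => ?_
      simp [rt, tl]; ring
  have lR : Real.log (∏ j, (z j ^ (sh N β k j - 1) * Real.exp (-(rt θ j * z j)))) =
      ∑ n ∈ range N, ((β / 2 * ((N : ℝ) - n) - 1) * Real.log (ext0 z (2 * n)) +
        (β / 2 * ((N : ℝ) - n - 1) + k - 1) * Real.log (ext0 z (2 * n + 1))) -
      (z 0 + (∑ i, tl z i) / θ) := by
    rw [Real.log_prod fun j _ => (hzp j).ne', ← hrt]
    have : ∀ j : Fin (2 * N - 1 + 1), Real.log (z j ^ (sh N β k j - 1) * Real.exp (-(rt θ j * z j)))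
        = (sh N β k j - 1) * Real.log (ext0 z j) - rt θ j * z j := by
      intro j
      rw [Real.log_mul (Real.rpow_pos_of_pos (hz j) _).ne' (Real.exp_pos _).ne', Real.log_exp,
        Real.log_rpow (hz j), ext0_apply]
      ring
    rw [sum_congr rfl fun j _ => this j, sum_sub_distrib]
    congr 1
    rw [Fin.sum_univ_eq_sum_range (fun j => (sh N β k j - 1) * Real.log (ext0 z j)),
      hr2, sum_two]
    simp_rw [sh_even, sh_odd]
  refine Real.log_injOn_pos (Set.mem_Ioi.2 (mul_pos hM (div_pos (mul_pos hF hq) hPd)))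
    (Set.mem_Ioi.2 (prod_pos fun j _ => hzp j)) ?_
  rw [Real.log_mul hM.ne' (div_pos (mul_pos hF hq) hPd).ne', Real.log_div (mul_pos hF hq).ne' hPd.ne',
    Real.log_mul hF.ne' hq.ne', lF, lq, lP, lR, lM, lX, hsum, hw, sum_tri]
  have e1 : ∑ n ∈ range N, ((β / 2 * ((N : ℝ) - n) - 1) * Real.log (ext0 z (2 * n)) +
        (β / 2 * ((N : ℝ) - n - 1) + k - 1) * Real.log (ext0 z (2 * n + 1))) =
      β / 2 * (∑ n ∈ range N, ∑ j ∈ range (2 * n + 1), Real.log (ext0 z j)) -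
      ∑ n ∈ range N, Real.log (ext0 z (2 * n)) +
      (k - 1) * ∑ n ∈ range N, Real.log (ext0 z (2 * n + 1)) := by
    rw [sum_D, mul_sum, mul_sum, ← sum_sub_distrib, ← sum_add_distrib]
    exact sum_congr rfl fun n _ => by ring
  rw [e1, ← lD]
  ring
end

section

lemma lintegral_fin_prod {n : ℕ} (μ : Fin n → Measure ℝ) [∀ i, SigmaFinite (μ i)]
    (f : Fin n → ℝ → ℝ≥0∞) (hf : ∀ i, Measurable (f i)) :
    ∫⁻ x, ∏ i, f i (x i) ∂(Measure.pi μ) = ∏ i, ∫⁻ t, f i t ∂(μ i) := by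
  induction n with
  | zero => simp
  | succ n ih =>
    have hmp := (measurePreserving_piFinSuccAbove μ 0).symm
    rw [← hmp.lintegral_comp_emb (MeasurableEquiv.measurableEmbedding _)]
    simp only [MeasurableEquiv.piFinSuccAbove_symm_apply, Fin.insertNthEquiv, Equiv.coe_fn_mk,
      Fin.prod_univ_succ, Fin.insertNth_zero]
    have h1 : ∀ x : ℝ × (Fin n → ℝ), f 0 (Fin.cons (α := fun _ => ℝ) x.1 x.2 0) *
        ∏ i : Fin n, f i.succ (Fin.cons (α := fun _ => ℝ) x.1 x.2 i.succ) =
        f 0 x.1 * ∏ i : Fin n, f i.succ (x.2 i) := fun x => by simp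
    have h2 := lintegral_prod_mul (μ := μ 0) (ν := Measure.pi fun j : Fin n => μ j.succ)
      (f := f 0) (g := fun x => ∏ i : Fin n, f i.succ (x i)) (hf 0).aemeasurable
      (Measurable.aemeasurable (by
        refine Finset.measurable_prod _ fun i _ => ?_
        exact (hf i.succ).comp (measurable_pi_apply i)))
    rw [ih (fun j => μ j.succ) (fun j => f j.succ) (fun j => hf _)] at h2
    rw [← h2]
    exact lintegral_congr h1

lemma pi_withDensity {n : ℕ} (f : Fin n → ℝ → ℝ≥0∞) (hf : ∀ i, Measurable (f i))
    [∀ i, SigmaFinite ((volume : Measure ℝ).withDensity (f i))] :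
    Measure.pi (fun i => (volume : Measure ℝ).withDensity (f i)) =
      (volume : Measure (Fin n → ℝ)).withDensity (fun x => ∏ i, f i (x i)) := by
  refine Measure.pi_eq fun s hs => ?_
  rw [withDensity_apply _ (MeasurableSet.univ_pi hs), ← lintegral_indicator (MeasurableSet.univ_pi hs)]
  have h1 : ∀ x : Fin n → ℝ, (Set.univ.pi s).indicator (fun x => ∏ i, f i (x i)) x =
      ∏ i, (s i).indicator (f i) (x i) := by
    intro x
    by_cases hx : x ∈ Set.univ.pi s
    · rw [Set.indicator_of_mem hx]
      exact prod_congr rfl fun i _ => (Set.indicator_of_mem (hx i (Set.mem_univ i)) _).symm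
    · rw [Set.indicator_of_notMem hx]
      simp only [Set.mem_pi, not_forall] at hx
      obtain ⟨i, _, hi⟩ := hx
      exact (prod_eq_zero (mem_univ i) (Set.indicator_of_notMem hi _)).symm
  rw [lintegral_congr h1]
  rw [volume_pi, lintegral_fin_prod _ _ fun i => (hf i).indicator (hs i)]
  exact prod_congr rfl fun i _ => by
    rw [withDensity_apply _ (hs i), lintegral_indicator (hs i)]

/-- Gamma density supported on the open half-line. -/
def gd (a r : ℝ) (x : ℝ) : ℝ≥0∞ :=
  (Set.Ioi (0 : ℝ)).indicator
    (fun x => ENNReal.ofReal (r ^ a / Real.Gamma a) * ENNReal.ofReal (x ^ (a - 1) * Real.exp (-(r * x)))) x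

lemma measurable_gd (a r : ℝ) : Measurable (gd a r) := by
  refine Measurable.indicator ?_ measurableSet_Ioi
  fun_prop

lemma gammaMeasure_eq (a r : ℝ) (ha : 0 < a) (hr : 0 < r) :
    gammaMeasure a r = volume.withDensity (gd a r) := by
  rw [gammaMeasure]
  refine withDensity_congr_ae ?_
  have : ∀ᵐ x : ℝ, x ≠ 0 := by simp [ae_iff]
  filter_upwards [this] with x hx
  rw [gammaPDF, gammaPDFReal, gd]
  by_cases h : 0 ≤ x
  · have h' : 0 < x := lt_of_le_of_ne h (Ne.symm hx)
    rw [if_pos h, Set.indicator_of_mem (Set.mem_Ioi.2 h'), ← ENNReal.ofReal_mul (by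
      have := Real.Gamma_pos_of_pos ha; positivity)]
    congr 1; ring
  · rw [if_neg h, Set.indicator_of_notMem (by simpa using (not_le.1 h).le)]
    simp

variable {N : ℕ}

lemma cov (hN : 0 < N) (h : (Fin (2 * N - 1 + 1) → ℝ) → ℝ≥0∞) :
    ∫⁻ z in Uset _, ENNReal.ofReal (Mdet z) * h (Smap hN z) =
      ∫⁻ y in Wset hN, ENNReal.ofReal (Pdet hN y) * h y := by
  have hU := (Uset_isOpen (2 * N - 1 + 1)).measurableSet
  have hW := (Wset_isOpen hN).measurableSet
  have hWinj : Set.InjOn (Pmap (hmN hN)) (Wset hN) := 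
    (Pmap_injOn (hmN hN)).mono fun y hy => hy.1
  set G : (Fin (2 * N - 1 + 1) → ℝ) → ℝ≥0∞ := 
    fun v => h (Function.invFunOn (Pmap (hmN hN)) (Wset hN) v) with hG
  have hGP : ∀ y ∈ Wset hN, G (Pmap (hmN hN) y) = h y := fun y hy => by
    simp only [hG]
    rw [hWinj.leftInvOn_invFunOn hy]
  have h1 := lintegral_image_eq_lintegral_abs_det_fderiv_mul volume hU
    (f := Mmap) (f' := fderiv ℝ Mmap) (fun z _ => 
      (((contDiff_Mmap _).differentiable one_ne_zero) z).hasFDerivAt.hasFDerivWithinAt)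
    (Mmap_injOn _) G
  have h2 := lintegral_image_eq_lintegral_abs_det_fderiv_mul volume hW
    (f := Pmap (hmN hN)) (f' := fderiv ℝ (Pmap (hmN hN))) (fun z _ => 
      (((contDiff_Pmap _).differentiable one_ne_zero) z).hasFDerivAt.hasFDerivWithinAt)
    hWinj G
  rw [image_eq hN, h2] at h1
  have e1 : ∫⁻ z in Uset _, ENNReal.ofReal (Mdet z) * h (Smap hN z) =
      ∫⁻ z in Uset _, ENNReal.ofReal |(fderiv ℝ Mmap z).det| * G (Mmap z) := by
    refine setLIntegral_congr_fun hU fun z hz => ?_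
    rw [det_fderiv_Mmap, abs_of_pos (Mdet_pos z hz), ← Pmap_Smap hN z (fun i => (hz i).le),
      hGP _ (Smap_mem hN z hz)]
  have e2 : ∫⁻ y in Wset hN, ENNReal.ofReal (Pdet hN y) * h y =
      ∫⁻ z in Wset hN, ENNReal.ofReal |(fderiv ℝ (Pmap (hmN hN)) z).det| * G (Pmap (hmN hN) z) := by
    refine setLIntegral_congr_fun hW fun z hz => ?_
    rw [abs_det_fderiv_Pmap, hGP _ hz, Pdet]
  rw [e1, e2, h1]

/-- The eigenvalue map. -/
def eg (ξ : Fin (2 * N - 1) → ℝ) : Fin N → ℝ := jacobiEigs (xiToA ξ) (xiToB ξ)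

lemma measurable_inter (hN : 0 < N) {A : Set (Fin N → ℝ)} (hA : MeasurableSet A) :
    MeasurableSet (Uset (2 * N - 1 + 1) ∩ (fun z => eg (tl z)) ⁻¹' A) := by
  have hWinj : Set.InjOn (Pmap (hmN hN)) (Wset hN) := 
    (Pmap_injOn (hmN hN)).mono fun y hy => hy.1
  have hS : MeasurableSet (Pmap (hmN hN) '' (Wset hN ∩ xP (hmN hN) ⁻¹' A)) :=
    MeasurableSet.image_of_continuousOn_injOn
      ((Wset_isOpen hN).measurableSet.inter ((continuous_xP _).measurable hA))
      (contDiff_Pmap _).continuous.continuousOn (hWinj.mono Set.inter_subset_left)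
  have : Uset (2 * N - 1 + 1) ∩ (fun z => eg (tl z)) ⁻¹' A =
      Uset _ ∩ Mmap ⁻¹' (Pmap (hmN hN) '' (Wset hN ∩ xP (hmN hN) ⁻¹' A)) := by
    ext z
    refine and_congr_right fun hz => ?_
    have hP := Pmap_Smap hN z (fun i => (hz i).le)
    constructor
    · intro h
      refine ⟨_, ⟨Smap_mem hN z hz, ?_⟩, hP⟩
      rw [Set.mem_preimage, xP_Smap]; exact h
    · rintro ⟨y, ⟨hy, hyA⟩, h⟩
      have : y = Smap hN z := hWinj hy (Smap_mem hN z hz) (h.trans hP.symm)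
      rw [this, Set.mem_preimage, xP_Smap] at hyA
      exact hyA
  rw [this]
  exact (Uset_isOpen _).measurableSet.inter ((contDiff_Mmap _).continuous.measurable hS)

lemma measurable_indicator_eg (hN : 0 < N) :
    Measurable ((Uset (2 * N - 1)).indicator (eg (N := N))) := by
  intro A hA
  rw [Set.indicator_preimage]
  have h0 : MeasurableSet (Uset (2 * N - 1) ∩ eg (N := N) ⁻¹' A) := by
    have hc : Measurable (fun ξ : Fin (2 * N - 1) → ℝ => 
        (Fin.cons (1 : ℝ) ξ : Fin (2 * N - 1 + 1) → ℝ)) := by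
      refine measurable_pi_iff.2 fun i => ?_
      refine Fin.cases ?_ (fun j => ?_) i
      · simp
      · simpa using measurable_pi_apply j
    convert hc (measurable_inter hN hA) using 1
    ext ξ
    have ht : tl (Fin.cons (1 : ℝ) ξ : Fin (2 * N - 1 + 1) → ℝ) = ξ := by
      funext i; simp [tl]
    simp only [Set.mem_inter_iff, Set.mem_preimage, ht]
    refine and_congr_left fun _ => ?_
    simp only [Uset, Set.mem_ofPred_eq]
    constructor
    · intro h i
      refine Fin.cases ?_ (fun j => ?_) i
      · simp
      · simpa using h j
    · intro h i
      simpa using h i.succ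
  have hU := (Uset_isOpen (2 * N - 1)).measurableSet
  rw [Set.ite]
  refine MeasurableSet.union (by rwa [Set.inter_comm]) (MeasurableSet.diff ?_ hU)
  exact measurable_const hA

lemma lintegral_split (hN : 0 < N) (a b : (Fin N → ℝ) → ℝ≥0∞) (ha : Measurable a)
    (hb : Measurable b) :
    ∫⁻ y : Fin (2 * N - 1 + 1) → ℝ, a (xP (hmN hN) y) * b (wP (hmN hN) y) =
      (∫⁻ x, a x) * ∫⁻ w, b w := by
  have h1 := (volume_measurePreserving_piCongrLeft (fun _ : Fin (2 * N - 1 + 1) => ℝ) (eIdx (hmN hN)))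
  have h2 := (volume_measurePreserving_sumPiEquivProdPi_symm (fun _ : Fin N ⊕ Fin N => ℝ))
  have h3 := h1.comp h2
  rw [← lintegral_prod_mul ha.aemeasurable hb.aemeasurable]
  have hm : Measurable (fun y => a (xP (hmN hN) y) * b (wP (hmN hN) y)) :=
    (ha.comp (continuous_xP _).measurable).mul (hb.comp (continuous_wP _).measurable)
  rw [← h3.lintegral_comp hm]
  refine lintegral_congr fun p => ?_
  congr 2
  · funext i
    exact Equiv.piCongrLeft_apply_apply (fun _ : Fin (2 * N - 1 + 1) => ℝ) (eIdx (hmN hN)) _ _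
  · funext i
    exact Equiv.piCongrLeft_apply_apply (fun _ : Fin (2 * N - 1 + 1) => ℝ) (eIdx (hmN hN)) _ _
end

section
variable {N : ℕ}

lemma measurable_Fden (β k θ : ℝ) : Measurable (Fden (N := N) β k θ) := by
  unfold Fden vdm
  fun_prop

lemma measurable_qden (β : ℝ) : Measurable (qden (N := N) β) := by
  unfold qden
  fun_prop

/-- The region of positive decreasing vectors. -/
def CP (N : ℕ) : Set (Fin N → ℝ) := {x | x ∈ chamber N ∧ ∀ n, 0 < x n}

lemma measurableSet_CP (N : ℕ) : MeasurableSet (CP N) := by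
  have : CP N = chamber N ∩ Uset N := rfl
  rw [this]
  exact ((chamber_isOpen N).inter (Uset_isOpen N)).measurableSet

lemma core (hN : 0 < N) (β k θ : ℝ) {A : Set (Fin N → ℝ)} (hA : MeasurableSet A) :
    ∫⁻ z in Uset (2 * N - 1 + 1) ∩ (fun z => eg (tl z)) ⁻¹' A,
      ENNReal.ofReal (∏ j, (z j ^ (sh N β k j - 1) * Real.exp (-(rt θ j * z j)))) =
    (∫⁻ w, (Uset N).indicator (fun w => ENNReal.ofReal (qden β w)) w) *
      ((volume.withDensity fun x => ENNReal.ofReal ((CP N).indicator (Fden β k θ) x)) A) := by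
  set T := Uset (2 * N - 1 + 1) ∩ (fun z => eg (tl z)) ⁻¹' A with hT
  have hTm : MeasurableSet T := measurable_inter hN hA
  have hU := (Uset_isOpen (2 * N - 1 + 1)).measurableSet
  have hW := (Wset_isOpen hN).measurableSet
  set h : (Fin (2 * N - 1 + 1) → ℝ) → ℝ≥0∞ := (xP (hmN hN) ⁻¹' A).indicator
    (fun y => ENNReal.ofReal (Fden β k θ (xP (hmN hN) y) * qden β (wP (hmN hN) y) / Pdet hN y))
    with hh
  have e1 : ∫⁻ z in T, ENNReal.ofReal
      (∏ j, (z j ^ (sh N β k j - 1) * Real.exp (-(rt θ j * z j)))) =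
      ∫⁻ z in Uset _, ENNReal.ofReal (Mdet z) * h (Smap hN z) := by
    have hTU : T ∩ Uset _ = T := Set.inter_eq_left.2 Set.inter_subset_left
    rw [← hTU, ← setLIntegral_indicator hTm]
    refine setLIntegral_congr_fun hU fun z hz => ?_
    by_cases hzA : eg (tl z) ∈ A
    · have hz2 : Smap hN z ∈ xP (hmN hN) ⁻¹' A := by rw [Set.mem_preimage, xP_Smap]; exact hzA
      rw [Set.indicator_of_mem (show z ∈ T from ⟨hz, hzA⟩), hh, Set.indicator_of_mem hz2,
        ← ENNReal.ofReal_mul (Mdet_pos z hz).le, density_identity hN β k θ z hz]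
    · have hz2 : Smap hN z ∉ xP (hmN hN) ⁻¹' A := by rw [Set.mem_preimage, xP_Smap]; exact hzA
      rw [Set.indicator_of_notMem (show z ∉ T from fun h => hzA h.2), hh,
        Set.indicator_of_notMem hz2, mul_zero]
  set a : (Fin N → ℝ) → ℝ≥0∞ := A.indicator
    (fun x => ENNReal.ofReal ((CP N).indicator (Fden β k θ) x)) with ha
  set b : (Fin N → ℝ) → ℝ≥0∞ := (Uset N).indicator (fun w => ENNReal.ofReal (qden β w)) with hb
  have ham : Measurable a := 
    (((measurable_Fden β k θ).indicator (measurableSet_CP N)).ennreal_ofReal).indicator hA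
  have hbm : Measurable b := 
    ((measurable_qden β).ennreal_ofReal).indicator (Uset_isOpen N).measurableSet
  have e2 : ∫⁻ y in Wset hN, ENNReal.ofReal (Pdet hN y) * h y =
      ∫⁻ y, a (xP (hmN hN) y) * b (wP (hmN hN) y) := by
    rw [← lintegral_indicator hW]
    refine lintegral_congr fun y => ?_
    by_cases hy : y ∈ Wset hN
    · have hb1 : b (wP (hmN hN) y) = ENNReal.ofReal (qden β (wP (hmN hN) y)) :=
        Set.indicator_of_mem (show wP (hmN hN) y ∈ Uset N from hy.1.2) _
      have hc1 : (CP N).indicator (Fden β k θ) (xP (hmN hN) y) = Fden β k θ (xP (hmN hN) y) :=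
        Set.indicator_of_mem (show xP (hmN hN) y ∈ CP N from ⟨hy.1.1, hy.2⟩) _
      rw [Set.indicator_of_mem hy, hb1]
      by_cases hyA : xP (hmN hN) y ∈ A
      · rw [hh, Set.indicator_of_mem (show y ∈ xP (hmN hN) ⁻¹' A from hyA), ha,
          Set.indicator_of_mem hyA, hc1, ← ENNReal.ofReal_mul (Pdet_pos hN y hy).le,
          mul_div_cancel₀ _ (Pdet_pos hN y hy).ne', ENNReal.ofReal_mul]
        refine mul_nonneg (Real.rpow_nonneg (abs_nonneg _) _) (prod_nonneg fun n _ => ?_)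
        exact mul_nonneg (Real.rpow_nonneg (hy.2 n).le _) (Real.exp_pos _).le
      · rw [hh, Set.indicator_of_notMem (show y ∉ xP (hmN hN) ⁻¹' A from hyA), ha,
          Set.indicator_of_notMem hyA, mul_zero, zero_mul]
    · rw [Set.indicator_of_notMem hy]
      by_cases hw : wP (hmN hN) y ∈ Uset N
      · have hc1 : xP (hmN hN) y ∉ CP N := fun hc => hy ⟨⟨hc.1, hw⟩, hc.2⟩
        have : a (xP (hmN hN) y) = 0 := by
          rw [ha]
          by_cases hyA : xP (hmN hN) y ∈ A
          · rw [Set.indicator_of_mem hyA, Set.indicator_of_notMem hc1, ENNReal.ofReal_zero]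
          · rw [Set.indicator_of_notMem hyA]
        rw [this, zero_mul]
      · rw [hb, Set.indicator_of_notMem hw, mul_zero]
  rw [e1, cov hN h, e2, lintegral_split hN a b ham hbm, withDensity_apply _ hA,
    ← lintegral_indicator hA, mul_comm]

/-- The extended product of gamma measures. -/
def GM (N : ℕ) (β k θ : ℝ) : Measure (Fin (2 * N - 1 + 1) → ℝ) :=
  Measure.pi fun j : Fin (2 * N - 1 + 1) => gammaMeasure (sh N β k j) (rt θ j)

/-- The normalising constant. -/
def KK (N : ℕ) (β k θ : ℝ) : ℝ≥0∞ :=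
  ∏ j : Fin (2 * N - 1 + 1), ENNReal.ofReal (rt θ j ^ sh N β k j / Real.Gamma (sh N β k j))

lemma GM_eq (hN : 0 < N) (β k θ : ℝ) (hβ : 0 < β) (hk : 0 < k) (hθ : 0 < θ) :
    GM N β k θ = volume.withDensity ((Uset _).indicator fun z => KK N β k θ * 
      ENNReal.ofReal (∏ j, (z j ^ (sh N β k j - 1) * Real.exp (-(rt θ j * z j))))) := by
  have hs : ∀ j : Fin (2 * N - 1 + 1), 0 < sh N β k j := fun j =>
    sh_pos N β k hβ hk j (by have := j.2; omega)
  have hg : ∀ j : Fin (2 * N - 1 + 1), gammaMeasure (sh N β k j) (rt θ j) = 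
      volume.withDensity (gd (sh N β k j) (rt θ j)) := fun j =>
    gammaMeasure_eq _ _ (hs j) (rt_pos θ hθ j)
  have : ∀ j : Fin (2 * N - 1 + 1), SigmaFinite 
      ((volume : Measure ℝ).withDensity (gd (sh N β k j) (rt θ j))) := fun j => by
    rw [← hg j]
    have := isProbabilityMeasure_gammaMeasure (hs j) (rt_pos θ hθ j)
    infer_instance
  rw [GM]
  simp_rw [hg]
  rw [pi_withDensity _ fun j => measurable_gd _ _]
  congr 1
  funext z
  by_cases hz : z ∈ Uset _
  · rw [Set.indicator_of_mem hz, ENNReal.ofReal_prod_of_nonneg fun j _ => 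
      mul_nonneg (Real.rpow_nonneg (hz j).le _) (Real.exp_pos _).le, KK, ← prod_mul_distrib]
    exact prod_congr rfl fun j _ => Set.indicator_of_mem (Set.mem_Ioi.2 (hz j)) _
  · rw [Set.indicator_of_notMem hz]
    simp only [Uset, Set.mem_ofPred_eq, not_forall] at hz
    obtain ⟨j, hj⟩ := hz
    exact prod_eq_zero (mem_univ j) (Set.indicator_of_notMem hj _)

/-- The tail measure. -/
def TM (N : ℕ) (β k θ : ℝ) : Measure (Fin (2 * N - 1) → ℝ) :=
  Measure.pi fun i : Fin (2 * N - 1) =>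
    if (i : ℕ) % 2 = 0 then
      gammaMeasure (β / 2 * ((N : ℝ) - (((i : ℕ) : ℝ) / 2 + 1)) + k) θ⁻¹
    else
      gammaMeasure (β / 2 * ((N : ℝ) - ((((i : ℕ) : ℝ) - 1) / 2 + 1))) θ⁻¹

lemma TM_eq (β k θ : ℝ) : TM N β k θ = 
    Measure.pi fun i : Fin (2 * N - 1) => gammaMeasure (sh N β k (i.succ : Fin (2 * N - 1 + 1))) 
      (rt θ (i.succ : Fin (2 * N - 1 + 1))) := by
  rw [TM]
  congr 1
  funext i
  have hr : rt θ (i.succ : Fin (2 * N - 1 + 1)) = θ⁻¹ := by simp [rt]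
  rw [hr, sh, Fin.val_succ]
  by_cases h : (i : ℕ) % 2 = 0
  · rw [if_pos h, if_neg (by omega)]
    congr 1; push_cast; ring
  · rw [if_neg h, if_pos (by omega)]
    congr 1; push_cast; ring

lemma tl_preserving (hN : 0 < N) (β k θ : ℝ) (hβ : 0 < β) (hk : 0 < k) (hθ : 0 < θ) :
    MeasurePreserving tl (GM N β k θ) (TM N β k θ) := by
  have hs : ∀ j : Fin (2 * N - 1 + 1), 0 < sh N β k j := fun j =>
    sh_pos N β k hβ hk j (by have := j.2; omega)
  have hp : ∀ j : Fin (2 * N - 1 + 1), 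
      IsProbabilityMeasure (gammaMeasure (sh N β k j) (rt θ j)) := fun j =>
    isProbabilityMeasure_gammaMeasure (hs j) (rt_pos θ hθ j)
  have h1 := measurePreserving_piFinSuccAbove 
    (fun j : Fin (2 * N - 1 + 1) => gammaMeasure (sh N β k j) (rt θ j)) 0
  have h2 := (measurePreserving_snd (μ := gammaMeasure (sh N β k (0 : Fin (2 * N - 1 + 1))) 
    (rt θ (0 : Fin (2 * N - 1 + 1))))
    (ν := Measure.pi fun i : Fin (2 * N - 1) => gammaMeasure 
      (sh N β k (i.succ : Fin (2 * N - 1 + 1))) (rt θ (i.succ : Fin (2 * N - 1 + 1)))))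
  rw [TM_eq]
  exact h2.comp h1

lemma main_aux (hN : 0 < N) (β k θ : ℝ) (hβ : 0 < β) (hk : 0 < k) (hθ : 0 < θ) :
    ∃ c : ℝ≥0∞, c ≠ 0 ∧ c ≠ ⊤ ∧ Measure.map (eg (N := N)) (TM N β k θ) =
      c • (volume.withDensity fun x => ENNReal.ofReal ((CP N).indicator (Fden β k θ) x)) := by
  have htl := tl_preserving hN β k θ hβ hk hθ
  have hprob : IsProbabilityMeasure (TM N β k θ) := by
    have hp : ∀ j : Fin (2 * N - 1), 
      IsProbabilityMeasure (gammaMeasure (sh N β k (j.succ : Fin (2 * N - 1 + 1))) 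
        (rt θ (j.succ : Fin (2 * N - 1 + 1)))) := fun j =>
      isProbabilityMeasure_gammaMeasure (sh_pos N β k hβ hk _ (by have := j.succ.2; omega)) 
        (rt_pos θ hθ _)
    rw [TM_eq]; infer_instance
  have hUt := (Uset_isOpen (2 * N - 1)).measurableSet
  have hU := (Uset_isOpen (2 * N - 1 + 1)).measurableSet
  have hGU : (GM N β k θ) (Uset _)ᶜ = 0 := by
    rw [GM_eq hN β k θ hβ hk hθ, withDensity_apply _ hU.compl, ← lintegral_indicator hU.compl,
      Set.indicator_indicator]
    simp
  have hTU : (TM N β k θ) (Uset _)ᶜ = 0 := by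
    rw [← htl.measure_preimage hUt.compl.nullMeasurableSet]
    refine measure_mono_null (fun z hz => ?_) hGU
    intro hz2
    exact hz fun i => hz2 _
  have hae : AEMeasurable (eg (N := N)) (TM N β k θ) := by
    refine ⟨_, measurable_indicator_eg hN, ?_⟩
    have : ∀ᵐ ξ ∂(TM N β k θ), ξ ∈ Uset (2 * N - 1) := hTU
    filter_upwards [this] with ξ hξ
    rw [Set.indicator_of_mem hξ]
  have hpm : IsProbabilityMeasure (Measure.map (eg (N := N)) (TM N β k θ)) :=
    Measure.isProbabilityMeasure_map hae
  set c : ℝ≥0∞ := KK N β k θ * 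
    (∫⁻ w, (Uset N).indicator (fun w => ENNReal.ofReal (qden β w)) w) with hc
  have hmain : Measure.map (eg (N := N)) (TM N β k θ) =
      c • (volume.withDensity fun x => ENNReal.ofReal ((CP N).indicator (Fden β k θ) x)) := by
    ext A hA
    have hKK : KK N β k θ ≠ ⊤ := ENNReal.prod_ne_top fun j _ => ENNReal.ofReal_ne_top
    rw [Measure.map_apply_of_aemeasurable hae hA, 
      ← htl.measure_preimage (hae.nullMeasurableSet_preimage hA), GM_eq hN β k θ hβ hk hθ,
      withDensity_apply', setLIntegral_indicator hU, lintegral_const_mul' _ _ hKK,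
      Measure.smul_apply, smul_eq_mul, hc, mul_assoc, ← core hN β k θ hA]
    rfl
  refine ⟨c, ?_, ?_, hmain⟩
  · intro h0
    have := hpm.measure_univ
    rw [hmain, h0] at this
    simp at this
  · intro h0
    have := hpm.measure_univ
    rw [hmain, h0, Measure.smul_apply, smul_eq_mul] at this
    rcases eq_or_ne ((volume.withDensity fun x => 
      ENNReal.ofReal ((CP N).indicator (Fden β k θ) x)) Set.univ) 0 with h | h
    · rw [h] at this; simp at this
    · rw [ENNReal.top_mul h] at this; simp at this

end

/-- tridiagonal model for the Laguerre β-ensemble. -/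
theorem laguerre_beta_ensemble_tridiagonal
    (N : ℕ) (hN : 2 ≤ N) (β : ℝ) (hβ : 0 < β) (k θ : ℝ) (hk : 0 < k) (hθ : 0 < θ) :
    ∃ c : ℝ≥0∞, c ≠ 0 ∧ c ≠ ⊤ ∧
      Measure.map
        (fun ξ : Fin (2 * N - 1) → ℝ => jacobiEigs (xiToA ξ) (xiToB ξ))
        (Measure.pi fun i : Fin (2 * N - 1) =>
          if (i : ℕ) % 2 = 0 then
            gammaMeasure (β / 2 * ((N : ℝ) - (((i : ℕ) : ℝ) / 2 + 1)) + k) θ⁻¹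
          else
            gammaMeasure (β / 2 * ((N : ℝ) - ((((i : ℕ) : ℝ) - 1) / 2 + 1))) θ⁻¹)
        = c • (volume.withDensity fun x : Fin N → ℝ =>
            ENNReal.ofReal (Set.indicator {x : Fin N → ℝ | x ∈ chamber N ∧ ∀ n, 0 < x n}
              (fun x => |vdm x| ^ β *
                ∏ n : Fin N, (x n ^ (k - 1) * Real.exp (-(x n) / θ))) x)) := by
  exact main_aux (by omega) β k θ hβ hk hθ
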